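/- arXiv:2309.15961 — 4 statements merged into one kernel-verified Lean document; each statement's English description precedes it below -/
import Mathlib

section
/- Let V be a finite type and let F be a simple graph on V in which every vertex has degree at least 2 (i.e. F is leafless and has no trivial components). Let H be a subgraph of F, and let ∂H = {v ∈ H.verts : deg_H(v) < deg_F(v)} be the boundary of H in F. Then, as integers, 2·(χ(F) − χ(H)) ≤ −|∂H|, where χ(F) = |V| − |E(F)| and χ(H) = |H.verts| − |E(H)|. -/
theorem SimpleGraph.sum_ncard_neighborSet_eq_twice_ncard_edgeSet {V : Type*} [Fintype V]
    (G : SimpleGraph V) : ∑ v, (G.neighborSet v).ncard = 2 * G.edgeSet.ncard := by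
  classical
  rw [← G.coe_edgeFinset, Set.ncard_coe_finset, ← G.sum_degrees_eq_twice_card_edges]
  refine Finset.sum_congr rfl fun v _ => ?_
  rw [Set.ncard_eq_toFinset_card', ← G.card_neighborFinset_eq_degree, G.neighborFinset_def]

theorem Set.ncard_eq_sum_ite {V : Type*} [Fintype V] (s : Set V) [DecidablePred (· ∈ s)] :
    s.ncard = ∑ v, if v ∈ s then 1 else 0 := by
  rw [Finset.sum_boole, Set.ncard_eq_toFinset_card', Nat.cast_id]
  congr 1
  ext v
  simp

/-- **Lemma 3.1.** If `F` is a finite simple graph in which every vertex has degree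
at least 2 (leafless, no trivial components) and `H` is a subgraph of `F`, then
`2 (χ(F) − χ(H)) ≤ −|∂H|`, where `χ` is (number of vertices) − (number of edges) and
`∂H` is the set of vertices of `H` whose degree in `H` is smaller than in `F`. -/
theorem subgraph_euler_char_boundary_bound
    (V : Type*) [Fintype V] (F : SimpleGraph V)
    (hdeg : ∀ v : V, 2 ≤ (F.neighborSet v).ncard)
    (H : F.Subgraph) :
    2 * (((Fintype.card V : ℤ) - (F.edgeSet.ncard : ℤ)) -
        ((H.verts.ncard : ℤ) - (H.edgeSet.ncard : ℤ))) ≤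
      -(({v ∈ H.verts | (H.neighborSet v).ncard < (F.neighborSet v).ncard}.ncard : ℤ)) := by
  classical
  have hF := F.sum_ncard_neighborSet_eq_twice_ncard_edgeSet
  have hH : ∑ v, (H.neighborSet v).ncard = 2 * H.edgeSet.ncard := by
    rw [← H.edgeSet_spanningCoe]
    exact H.spanningCoe.sum_ncard_neighborSet_eq_twice_ncard_edgeSet
  have hle : ∀ v, (H.neighborSet v).ncard ≤ (F.neighborSet v).ncard := fun v =>
    Set.ncard_le_ncard (H.neighborSet_subset v) (Set.toFinite _)
  have key : ∑ v : V, (2 + (H.neighborSet v).ncard +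
      if v ∈ {v ∈ H.verts | (H.neighborSet v).ncard < (F.neighborSet v).ncard} then 1 else 0) ≤
      ∑ v : V, (2 * (if v ∈ H.verts then 1 else 0) + (F.neighborSet v).ncard) := by
    refine Finset.sum_le_sum fun v _ => ?_
    have h₁ := hle v
    have h₂ := hdeg v
    by_cases hv : v ∈ H.verts
    · simp only [Set.mem_ofPred_eq, hv, true_and, if_true]
      split_ifs <;> omega
    · have h₀ : H.neighborSet v = ∅ :=
        Set.eq_empty_of_forall_notMem fun w hw => hv (H.edge_vert hw)
      simp [hv, h₀, h₂]
  simp only [Finset.sum_add_distrib, ← Finset.mul_sum, ← Set.ncard_eq_sum_ite, hF, hH,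
    Finset.sum_const, Finset.card_univ, smul_eq_mul] at key
  omega
end

section
/- Let F be a finitely generated free group, H a subgroup of F, and Ψ : H → F an injective group homomorphism. Let G be the HNN extension of F associating H to Ψ(H), i.e. G = HNNExtension F H Ψ.range φ where φ : H ≃* Ψ.range is the isomorphism induced by Ψ, and let H̄ denote the image of H in G under the canonical map ι : F →* G. Suppose there exist n ≥ 1, a nontrivial subgroup K ≤ H whose n-fold Ψ-iterate K = K₀, …, K_n is defined (K_i ≤ H for all i < n, K_{i+1} = Ψ(K_i)), and g ∈ F with K_n ≤ g⁻¹Kg. Then H̄ has infinite height in G: for every N there exist N elements of G lying in pairwise distinct right cosets of H̄ such that the intersection of the corresponding conjugates of H̄ is infinite. -/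
/-- A subgroup `P` of a group `G` has *finite height*: there is an `N` such that
whenever `g₁, …, g_k` lie in pairwise distinct right cosets `P gᵢ` and the
intersection `⋂ᵢ gᵢ⁻¹ P gᵢ` of the corresponding conjugates is infinite, `k ≤ N`. -/
def HasFiniteHeight {G : Type*} [Group G] (P : Subgroup G) : Prop :=
  ∃ N : ℕ, ∀ (k : ℕ) (g : Fin k → G),
    (∀ i j : Fin k, g i * (g j)⁻¹ ∈ P → i = j) →
    Set.Infinite ((⨅ i, P.map ((MulAut.conj (g i)⁻¹).toMonoidHom) : Subgroup G) : Set G) →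
    k ≤ N

/-- `H` is a *proper free factor* of `F`: there is a nontrivial subgroup `K` of `F`
such that the canonical homomorphism `H ∗ K →* F` from the free product is bijective. -/
def IsProperFreeFactor {F : Type*} [Group F] (H : Subgroup F) : Prop :=
  ∃ K : Subgroup F, K ≠ ⊥ ∧ Function.Bijective (Monoid.Coprod.lift H.subtype K.subtype)

/-- `c` is the `n`-fold `Ψ`-iterate chain starting at `K`: `c 0 = K`,
`c i ≤ H` for `i < n`, and `c (i+1) = Ψ(c i)`. -/
def IterChain {F : Type*} [Group F] (H : Subgroup F) (Ψ : ↥H →* F)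
    (K : Subgroup F) (n : ℕ) (c : ℕ → Subgroup F) : Prop :=
  c 0 = K ∧ ∀ i < n, c i ≤ H ∧ c (i + 1) = Subgroup.map Ψ ((c i).subgroupOf H)

/-- A partial endomorphism `Ψ : H → F` is *fully irreducible* if there do not exist
`n ≥ 1`, a nontrivial proper free factor `H'` of `H` whose `n`-fold `Ψ`-iterate
`H' = K₀, …, K_n` is defined, and `g ∈ F` with `K_n ≤ g⁻¹ H' g`. -/
def FullyIrreducible {F : Type*} [Group F] (H : Subgroup F) (Ψ : ↥H →* F) : Prop :=
  ¬ ∃ (n : ℕ) (H' : Subgroup ↥H) (c : ℕ → Subgroup F) (g : F),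
      1 ≤ n ∧ H' ≠ ⊥ ∧ IsProperFreeFactor H' ∧
      IterChain H Ψ (H'.map H.subtype) n c ∧
      c n ≤ (H'.map H.subtype).map ((MulAut.conj g⁻¹).toMonoidHom)

namespace HNNExtension

variable {G : Type*} [Group G] {A B : Subgroup G} {φ : A ≃* B}

/-- The exponent sum of the stable letter. -/
def exponentSum : HNNExtension G A B φ →* Multiplicative ℤ :=
  lift 1 (Multiplicative.ofAdd 1) (by simp)

@[simp]
theorem exponentSum_of (x : G) : exponentSum (of x : HNNExtension G A B φ) = 1 := by
  simp [exponentSum]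

@[simp]
theorem exponentSum_t :
    exponentSum (t : HNNExtension G A B φ) = Multiplicative.ofAdd 1 := by
  simp [exponentSum]

end HNNExtension

/-- Along an iterate chain, the `i`-th power of the stable letter conjugates the first term
into the `i`-th one. -/
theorem IterChain.exists_conj_t_pow {F : Type*} [Group F] {H : Subgroup F} {Ψ : ↥H →* F}
    (hΨ : Function.Injective Ψ) {K : Subgroup F} {n : ℕ} {c : ℕ → Subgroup F}
    (hc : IterChain H Ψ K n c) {i : ℕ} (hi : i ≤ n) {x : F} (hx : x ∈ K) :
    ∃ y ∈ c i, (HNNExtension.of y : HNNExtension F H Ψ.range (MonoidHom.ofInjective hΨ)) =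
      HNNExtension.t ^ i * HNNExtension.of x * (HNNExtension.t ^ i)⁻¹ := by
  induction i with
  | zero => exact ⟨x, hc.1 ▸ hx, by simp⟩
  | succ i ih =>
    obtain ⟨y, hy, hyx⟩ := ih (by lia)
    obtain ⟨hle, hsucc⟩ := hc.2 i (by lia)
    refine ⟨Ψ ⟨y, hle hy⟩, hsucc ▸ ⟨⟨y, hle hy⟩, hy, rfl⟩, ?_⟩
    have h := HNNExtension.equiv_eq_conj (φ := MonoidHom.ofInjective hΨ) ⟨y, hle hy⟩
    rw [MonoidHom.ofInjective_apply] at h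
    rw [h, hyx, pow_succ']
    group

/-- **Self-conjugation implies infinite height** (the key direction of Theorem 1.3
and Lemma 4.6). If some nontrivial subgroup `K ≤ H` has a defined `n`-fold
`Ψ`-iterate (`n ≥ 1`) ending inside a conjugate `g⁻¹ K g`, then the image `H̄` of
`H` in the HNN extension `G` has infinite height: for every `N` there are `N`
elements of `G` in pairwise distinct right cosets of `H̄` such that the
intersection of the corresponding conjugates of `H̄` is infinite. -/
theorem infinite_height_of_self_conjugation {ι : Type} [Finite ι]
    (H : Subgroup (FreeGroup ι))
    (Ψ : ↥H →* FreeGroup ι) (hΨ : Function.Injective Ψ)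
    (hself : ∃ (n : ℕ) (K : Subgroup (FreeGroup ι)) (c : ℕ → Subgroup (FreeGroup ι))
        (g : FreeGroup ι), 1 ≤ n ∧ K ≠ ⊥ ∧ K ≤ H ∧ IterChain H Ψ K n c ∧
        c n ≤ K.map ((MulAut.conj g⁻¹).toMonoidHom)) :
    ∀ N : ℕ, ∃ g : Fin N →
        HNNExtension (FreeGroup ι) H Ψ.range (MonoidHom.ofInjective hΨ),
      (∀ i j : Fin N, g i * (g j)⁻¹ ∈
          H.map (HNNExtension.of : FreeGroup ι →*
            HNNExtension (FreeGroup ι) H Ψ.range (MonoidHom.ofInjective hΨ)) → i = j) ∧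
      Set.Infinite ((⨅ i, (H.map (HNNExtension.of : FreeGroup ι →*
          HNNExtension (FreeGroup ι) H Ψ.range (MonoidHom.ofInjective hΨ))).map
            ((MulAut.conj (g i)⁻¹).toMonoidHom) :
          Subgroup (HNNExtension (FreeGroup ι) H Ψ.range (MonoidHom.ofInjective hΨ))) :
        Set (HNNExtension (FreeGroup ι) H Ψ.range (MonoidHom.ofInjective hΨ))) := by
  obtain ⟨n, K, c, g, hn, hK, hKH, hc, hcg⟩ := hself
  let of : FreeGroup ι →* HNNExtension (FreeGroup ι) H Ψ.range (MonoidHom.ofInjective hΨ) :=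
    HNNExtension.of
  let s : HNNExtension (FreeGroup ι) H Ψ.range (MonoidHom.ofInjective hΨ) :=
    of g * HNNExtension.t ^ n
  have conj_mem : ∀ x ∈ K.map of, s * x * s⁻¹ ∈ K.map of := by
    rintro _ ⟨x, hx, rfl⟩
    obtain ⟨y, hy, hyx⟩ := hc.exists_conj_t_pow hΨ le_rfl hx
    obtain ⟨z, hz, rfl⟩ := hcg hy
    refine ⟨z, hz, ?_⟩
    simp only [MulEquiv.coe_toMonoidHom, map_inv, MulAut.conj_inv_apply, map_mul] at hyx
    calc of z = of g * ((of g)⁻¹ * of z * of g) * (of g)⁻¹ := by group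
      _ = of g * (HNNExtension.t ^ n * of x * (HNNExtension.t ^ n)⁻¹) * (of g)⁻¹ := by
        rw [← hyx]
      _ = s * of x * s⁻¹ := by simp only [s, mul_inv_rev, mul_assoc]
  have conj_pow_mem (i : ℕ) : ∀ x ∈ K.map of, s ^ i * x * (s ^ i)⁻¹ ∈ K.map of := by
    induction i with
    | zero => simp
    | succ i ih =>
      intro x hx
      convert conj_mem _ (ih x hx) using 1
      rw [pow_succ']
      group
  intro N
  refine ⟨fun i => s ^ (i : ℕ), ?_, ?_⟩
  · rintro i j ⟨x, -, hx⟩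
    have h : (i : ℤ) * n = j * n := by
      have := congrArg (fun y => (HNNExtension.exponentSum y).toAdd) hx
      simp only [HNNExtension.exponentSum_of, HNNExtension.exponentSum_t, map_mul, map_inv,
        map_pow, one_mul, toAdd_one, toAdd_mul, toAdd_inv, toAdd_pow, toAdd_ofAdd,
        nsmul_eq_mul, mul_one, s, of] at this
      linarith
    exact Fin.ext (Nat.eq_of_mul_eq_mul_right hn (by exact_mod_cast h))
  · have hKinf : (K : Set (FreeGroup ι)).Infinite := by
      have : Nontrivial K := K.nontrivial_iff_ne_bot.mpr hK
      obtain ⟨x, hx⟩ := exists_ne (1 : K)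
      have : Infinite K := Infinite.of_injective _
        (injective_zpow_iff_not_isOfFinOrder.mpr (not_isOfFinOrder_of_isMulTorsionFree hx))
      exact Set.infinite_coe_iff.mp this
    refine (hKinf.image (f := of) (HNNExtension.of_injective _).injOn).mono ?_
    rintro _ ⟨x, hx, rfl⟩
    simp only [SetLike.mem_coe, Subgroup.mem_iInf]
    intro i
    refine ⟨s ^ (i : ℕ) * of x * (s ^ (i : ℕ))⁻¹,
      Subgroup.map_mono hKH (conj_pow_mem i _ ⟨x, hx, rfl⟩), ?_⟩
    simp only [MulEquiv.coe_toMonoidHom, MulAut.conj_apply, inv_inv]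
    group
end

section
/- Let F be a finitely generated free group, H a proper free factor of F, and Ψ : H → F an injective group homomorphism such that the image Ψ(H) intersects every conjugate of H trivially: Ψ.range ⊓ g⁻¹Hg = ⊥ for all g ∈ F. Let G be the HNN extension of F associating H to Ψ(H), i.e. G = HNNExtension F H Ψ.range φ where φ : H ≃* Ψ.range is the isomorphism induced by Ψ, and let H̄ denote the image of H in G under the canonical map ι : F →* G. Then H̄ has finite height in G. -/
namespace FreeGroup

variable {α : Type*}

theorem mk_eq_mk_of_red {L₁ L₂ : List (α × Bool)} (h : Red L₁ L₂) : mk L₁ = mk L₂ := by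
  classical exact reduce.exact (reduce.eq_of_red h)

/-- `p` and `p'` are joined by an edge path of the Cayley tree all of whose vertices lie in `C`. -/
def JoinedByWord (C : Set (FreeGroup α)) (p p' : FreeGroup α) : Prop :=
  ∃ L : List (α × Bool), p * mk L = p' ∧ ∀ L', L' <+: L → p * mk L' ∈ C

namespace JoinedByWord

variable {C : Set (FreeGroup α)} {p p' p'' : FreeGroup α}

theorem trans (h : JoinedByWord C p p') (h' : JoinedByWord C p' p'') :
    JoinedByWord C p p'' := by
  obtain ⟨L, rfl, hL⟩ := h
  obtain ⟨M, rfl, hM⟩ := h'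
  refine ⟨L ++ M, by rw [← mul_mk, mul_assoc], fun X hX => ?_⟩
  rcases List.prefix_or_prefix_of_prefix hX (List.prefix_append L M) with hX' | ⟨Y, rfl⟩
  · exact hL X hX'
  · rw [← mul_mk, ← mul_assoc]
    exact hM Y ((List.prefix_append_right_inj L).1 hX)

theorem symm (h : JoinedByWord C p p') : JoinedByWord C p' p := by
  obtain ⟨L, rfl, hL⟩ := h
  refine ⟨invRev L, by rw [← inv_mk]; group, ?_⟩
  rintro X ⟨Y, hXY⟩
  have hL' : L = invRev Y ++ invRev X := by rw [← invRev_append, hXY, invRev_invRev]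
  have := hL (invRev Y) ⟨invRev X, hL'.symm⟩
  rwa [hL', ← mul_mk, ← inv_mk (L := X), mul_assoc, inv_mul_cancel_right]

theorem mul_left {q : FreeGroup α} (hq : ∀ c ∈ C, q * c ∈ C) (h : JoinedByWord C p p') :
    JoinedByWord C (q * p) (q * p') := by
  obtain ⟨L, rfl, hL⟩ := h
  exact ⟨L, mul_assoc _ _ _, fun X hX => by rw [mul_assoc]; exact hq _ (hL X hX)⟩

/-- A subset of the Cayley tree through which two vertices are joined contains the geodesic
between them. -/
theorem mem_of_prefix {w w' : List (α × Bool)} (hw : IsReduced w)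
    (h : JoinedByWord C p (p * mk w)) (hw' : w' <+: w) : p * mk w' ∈ C := by
  classical
  obtain ⟨L, hLw, hL⟩ := h
  obtain ⟨v, rfl⟩ := hw'
  have hred : Red L (w' ++ v) := by
    have := reduce.red (L := L)
    rwa [reduce.sound (mul_left_cancel hLw), hw.reduce_eq] at this
  obtain ⟨L₁, L₂, rfl, h₁, -⟩ := Red.to_append_iff.1 hred
  rw [← mk_eq_mk_of_red h₁]
  exact hL L₁ (List.prefix_append _ _)

end JoinedByWord

/-- If `C` is a connected subset of the Cayley tree invariant under a subgroup `Q`, then the axis of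
every element of `Q` is contained in `C`. -/
theorem mem_of_conj_isCyclicallyReduced {Q : Subgroup (FreeGroup α)} {C : Set (FreeGroup α)}
    (hQC : ∀ q ∈ Q, ∀ c ∈ C, q * c ∈ C) (h_one : 1 ∈ C)
    (hC : ∀ c ∈ C, JoinedByWord C 1 c) {z : List (α × Bool)} (hz : IsCyclicallyReduced z)
    (hz_nil : z ≠ []) {f : FreeGroup α} (hf : f * mk z * f⁻¹ ∈ Q) : f ∈ C := by
  classical
  have hjoin {p p' : FreeGroup α} (hp : p ∈ C) (hp' : p' ∈ C) : JoinedByWord C p p' :=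
    (hC p hp).symm.trans (hC p' hp')
  set n := 4 * f.norm + 1
  set Z := (List.replicate n z).flatten with hZ_def
  have hZ : mk Z = mk z ^ n := (pow_mk n).symm
  have hZ_len : 4 * f.norm + 1 ≤ Z.length := by
    have : 1 ≤ z.length := List.length_pos_iff.2 hz_nil
    simp only [hZ_def, List.length_flatten, List.map_replicate, List.sum_replicate, smul_eq_mul]
    exact Nat.le_mul_of_pos_right n this
  have hZZ : IsReduced (Z ++ Z) := by
    have := (hz.flatten_replicate (n + n)).isReduced
    rwa [List.replicate_add, List.flatten_append] at this
  have hZ_norm : (mk Z).norm = Z.length := by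
    rw [norm, toWord_mk, (hz.flatten_replicate n).isReduced.reduce_eq]
  have hq : f * mk Z * f⁻¹ ∈ Q := by
    rw [hZ, ← conj_pow]; exact pow_mem hf n
  set R := (f * mk Z * f⁻¹).toWord with hR_def
  have hR_len : 2 * f.norm ≤ R.length := by
    have h₁ := norm_mul_le (f⁻¹ * (f * mk Z * f⁻¹)) f
    have h₂ := norm_mul_le f⁻¹ (f * mk Z * f⁻¹)
    have h₃ : f⁻¹ * (f * mk Z * f⁻¹) * f = mk Z := by group
    rw [h₃] at h₁
    rw [norm_inv_eq] at h₂
    have h₄ : (f * mk Z * f⁻¹).norm = R.length := rfl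
    omega
  have hred : Red (f.toWord ++ Z ++ invRev f.toWord)
      (R.take f.norm ++ R.drop f.norm) := by
    rw [List.take_append_drop, hR_def]
    have : (f * mk Z * f⁻¹).toWord = reduce (f.toWord ++ Z ++ invRev f.toWord) := by
      rw [← toWord_mk, ← mul_mk, ← mul_mk, ← inv_mk, mk_toWord]
    rw [this]
    exact reduce.red
  obtain ⟨U₁, U₂, hU, h₁, h₂⟩ := Red.to_append_iff.1 hred
  have hl₁ := h₁.length_le
  have hl₂ := h₂.length_le
  rw [List.length_take] at hl₁
  rw [List.length_drop] at hl₂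
  have hf_len : f.toWord.length = f.norm := rfl
  obtain ⟨X, rfl⟩ : f.toWord <+: U₁ := by
    refine List.prefix_of_prefix_length_le (l₃ := U₁ ++ U₂) ?_ (List.prefix_append _ _) (by omega)
    rw [← hU, List.append_assoc]
    exact List.prefix_append _ _
  obtain ⟨Y, hXY⟩ : X <+: Z := by
    have hU' : X ++ U₂ = Z ++ invRev f.toWord := by simpa using hU.symm
    have hl := congrArg List.length hU'
    simp only [List.length_append, invRev_length] at hl
    exact List.prefix_of_prefix_length_le (l₃ := X ++ U₂) (List.prefix_append _ _)
      (hU' ▸ List.prefix_append _ _) (by omega)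
  have hX : f * mk X ∈ C := by
    have hR : JoinedByWord C 1 (1 * mk R) := by
      refine hC _ ?_
      rw [one_mul, hR_def, mk_toWord]
      simpa using hQC _ hq 1 h_one
    have := hR.mem_of_prefix isReduced_toWord (List.take_prefix f.norm R)
    rw [one_mul, ← mk_eq_mk_of_red h₁, ← mul_mk, mk_toWord] at this
    exact this
  have hX' : (f * mk Z * f⁻¹)⁻¹ * (f * mk X) ∈ C := hQC _ (inv_mem hq) _ hX
  have hYX : IsReduced (Y ++ X) := hZZ.infix ⟨X, Y, by rw [← hXY]; simp⟩
  have hZ' : mk Z = mk X * mk Y := by rw [mul_mk, hXY]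
  have key : (f * mk Z * f⁻¹)⁻¹ * (f * mk X) * mk Y = f := by
    rw [mul_assoc _ (f * mk X), mul_assoc f (mk X), ← hZ']; group
  have := (hjoin hX' (p' := (f * mk Z * f⁻¹)⁻¹ * (f * mk X) * mk (Y ++ X))
    (by rwa [← mul_mk, ← mul_assoc, key])).mem_of_prefix hYX (List.prefix_append _ _)
  rwa [key] at this

/-- The union of the geodesics joining vertices `q` and `q * s` with `q` in the subgroup generated
by `S` and `s ∈ S`. -/
def geodesicHull [DecidableEq α] (S : Set (FreeGroup α)) : Set (FreeGroup α) :=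
  {p | ∃ q ∈ Subgroup.closure S, ∃ w, (w = [] ∨ ∃ s ∈ S, w <+: s.toWord) ∧ p = q * mk w}

section geodesicHull

variable [DecidableEq α] {S : Set (FreeGroup α)}

theorem mem_geodesicHull_of_mem_closure {q : FreeGroup α} (hq : q ∈ Subgroup.closure S) :
    q ∈ geodesicHull S :=
  ⟨q, hq, [], .inl rfl, by rw [← one_eq_mk, mul_one]⟩

theorem mul_mem_geodesicHull {q c : FreeGroup α} (hq : q ∈ Subgroup.closure S)
    (hc : c ∈ geodesicHull S) : q * c ∈ geodesicHull S := by
  obtain ⟨r, hr, w, hw, rfl⟩ := hc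
  exact ⟨q * r, mul_mem hq hr, w, hw, (mul_assoc _ _ _).symm⟩

theorem joinedByWord_one_mk {L : List (α × Bool)} (hL : L = [] ∨ ∃ s ∈ S, L <+: s.toWord) :
    JoinedByWord (geodesicHull S) 1 (mk L) := by
  refine ⟨L, one_mul _, fun X hX => ⟨1, one_mem _, X, ?_, rfl⟩⟩
  rcases hL with rfl | ⟨s, hs, hLs⟩
  · exact .inl (List.prefix_nil.1 hX)
  · exact .inr ⟨s, hs, hX.trans hLs⟩

theorem joinedByWord_one_of_mem_closure {q : FreeGroup α} (hq : q ∈ Subgroup.closure S) :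
    JoinedByWord (geodesicHull S) 1 q := by
  induction hq using Subgroup.closure_induction with
  | mem s hs => simpa only [mk_toWord] using joinedByWord_one_mk (L := s.toWord) (.inr ⟨s, hs, List.prefix_rfl⟩)
  | one => exact joinedByWord_one_mk (.inl rfl)
  | mul x y hx _ ihx ihy =>
    refine ihx.trans ?_
    simpa using ihy.mul_left fun c hc => mul_mem_geodesicHull hx hc
  | inv x hx ih =>
    simpa using (ih.mul_left fun c hc => mul_mem_geodesicHull (inv_mem hx) hc).symm

theorem joinedByWord_one_of_mem_geodesicHull {c : FreeGroup α} (hc : c ∈ geodesicHull S) :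
    JoinedByWord (geodesicHull S) 1 c := by
  obtain ⟨q, hq, w, hw, rfl⟩ := hc
  refine (joinedByWord_one_of_mem_closure hq).trans ?_
  simpa using (joinedByWord_one_mk hw).mul_left fun c hc => mul_mem_geodesicHull hq hc

/-- The elements conjugating a given nontrivial element into the subgroup generated by `S` lie, up
to a common right translation, in the hull of `S`. -/
theorem exists_mul_mem_geodesicHull {y : FreeGroup α} (hy : y ≠ 1) :
    ∃ c : FreeGroup α, ∀ f, f * y * f⁻¹ ∈ Subgroup.closure S → f * c ∈ geodesicHull S := by
  set z := reduceCyclically y.toWord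
  set c := mk (reduceCyclically.conjugator y.toWord)
  have hyc : y = c * mk z * c⁻¹ := by
    rw [inv_mk, mul_mk, mul_mk, reduceCyclically.conj_conjugator_reduceCyclically, mk_toWord]
  have hz : z ≠ [] := by
    intro hz
    rw [hz, ← one_eq_mk, mul_one, mul_inv_cancel] at hyc
    exact hy hyc
  refine ⟨c, fun f hf => mem_of_conj_isCyclicallyReduced (Q := Subgroup.closure S)
    (fun q hq x hx => mul_mem_geodesicHull hq hx)
    (mem_geodesicHull_of_mem_closure (one_mem _))
    (fun x hx => joinedByWord_one_of_mem_geodesicHull hx)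
    (reduceCyclically.isCyclicallyReduced isReduced_toWord) hz ?_⟩
  have hfc : f * c * mk z * (f * c)⁻¹ = f * (c * mk z * c⁻¹) * f⁻¹ := by
    rw [mul_inv_rev]
    simp only [mul_assoc]
  rwa [hfc, ← hyc]

end geodesicHull

/-- A nontrivial element of a free group fixes a bounded number of cosets of a finitely generated
subgroup. -/
theorem exists_card_le_of_conj_mem {Q : Subgroup (FreeGroup α)} (hQ : Q.FG) :
    ∃ N : ℕ, ∀ y : FreeGroup α, y ≠ 1 → ∀ (k : ℕ) (f : Fin k → FreeGroup α),
      (∀ i, f i * y * (f i)⁻¹ ∈ Q) → (∀ i j, f i * (f j)⁻¹ ∈ Q → i = j) → k ≤ N := by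
  classical
  obtain ⟨S, rfl⟩ := hQ
  set W : Set (List (α × Bool)) := {w | w = [] ∨ ∃ s ∈ (S : Set (FreeGroup α)), w <+: s.toWord}
  have hW : W.Finite := by
    have : W ⊆ {[]} ∪ ⋃ s ∈ (S : Set (FreeGroup α)), {w | w ∈ s.toWord.inits} := by
      rintro w (rfl | ⟨s, hs, hw⟩)
      · simp
      · exact .inr (Set.mem_biUnion hs ((List.mem_inits _ _).2 hw))
    exact ((Set.finite_singleton _).union
      (S.finite_toSet.biUnion fun s _ => List.finite_toSet _)).subset this
  refine ⟨W.ncard, fun y hy k f hf hinj => ?_⟩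
  obtain ⟨c, hc⟩ := exists_mul_mem_geodesicHull (S := (S : Set (FreeGroup α))) hy
  choose q hq w hw hqw using fun i => hc (f i) (hf i)
  have hw_inj : Function.Injective w := by
    intro i j hij
    refine hinj i j ?_
    have : f i * (f j)⁻¹ = q i * (q j)⁻¹ := by
      rw [← mul_inv_eq_iff_eq_mul.2 (hqw i).symm, ← mul_inv_eq_iff_eq_mul.2 (hqw j).symm, hij]
      group
    rw [this]
    exact mul_mem (hq i) (inv_mem (hq j))
  calc k = (Set.range w).ncard := by
        rw [← Set.image_univ, Set.ncard_image_of_injective _ hw_inj, Set.ncard_univ,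
          Nat.card_fin]
    _ ≤ W.ncard := Set.ncard_le_ncard (Set.range_subset_iff.2 hw) hW

/-- A subgroup of a free group generated by basis elements is malnormal. -/
theorem mem_closure_of_conj_mem_closure {A : Set α} {f h : FreeGroup α} (h_ne : h ≠ 1)
    (hh : h ∈ Subgroup.closure (of '' A)) (hf : f * h * f⁻¹ ∈ Subgroup.closure (of '' A)) :
    f ∈ Subgroup.closure (of '' A) := by
  classical
  have hull {p : FreeGroup α} (hp : p ∈ geodesicHull (of '' A)) :
      p ∈ Subgroup.closure (of '' A) := by
    obtain ⟨q, hq, w, hw, rfl⟩ := hp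
    refine mul_mem hq ?_
    rcases hw with rfl | ⟨_, ⟨a, ha, rfl⟩, hw⟩
    · exact one_mem _
    · rw [toWord_of, List.prefix_cons_iff] at hw
      rcases hw with rfl | ⟨t, rfl, ht⟩
      · exact one_mem _
      · rw [List.prefix_nil.1 ht]
        exact Subgroup.subset_closure ⟨a, ha, rfl⟩
  obtain ⟨c, hc⟩ := exists_mul_mem_geodesicHull (S := of '' A) h_ne
  have h₁ := hull (hc f hf)
  have h₂ := hull (hc 1 (by simpa using hh))
  rw [one_mul] at h₂
  exact (Subgroup.mul_mem_cancel_right _ h₂).1 h₁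

end FreeGroup

theorem IsProperFreeFactor.fg {F : Type*} [Group F] [Group.FG F] {H : Subgroup F}
    (hH : IsProperFreeFactor H) : Group.FG H := by
  obtain ⟨K, -, hK⟩ := hH
  let e := MulEquiv.ofBijective _ hK
  refine Group.fg_of_surjective (f := (Monoid.Coprod.fst (M := H) (N := K)).comp e.symm.toMonoidHom)
    fun h => ⟨e (Monoid.Coprod.inl h), by simp⟩

/-- A free factor of a free group is malnormal. -/
theorem IsProperFreeFactor.mem_of_conj_mem {F : Type} [Group F] [IsFreeGroup F] {H : Subgroup F}
    (hH : IsProperFreeFactor H) {f h : F} (h_ne : h ≠ 1) (hh : h ∈ H) (hf : f * h * f⁻¹ ∈ H) :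
    f ∈ H := by
  obtain ⟨K, -, hK⟩ := hH
  obtain ⟨σ, ⟨b⟩⟩ := IsFreeGroup.nonempty_basis (G := H)
  obtain ⟨τ, ⟨c⟩⟩ := IsFreeGroup.nonempty_basis (G := K)
  let e := MulEquiv.ofBijective _ hK
  let θ : FreeGroup (σ ⊕ τ) →* F := FreeGroup.lift
    (Sum.elim (fun s => (b.repr.symm (.of s) : F)) (fun s => (c.repr.symm (.of s) : F)))
  let η : Monoid.Coprod H K →* FreeGroup (σ ⊕ τ) := Monoid.Coprod.lift
    ((FreeGroup.map Sum.inl).comp b.repr.toMonoidHom)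
    ((FreeGroup.map Sum.inr).comp c.repr.toMonoidHom)
  have hθ_inl : θ.comp (FreeGroup.map Sum.inl) = H.subtype.comp b.repr.symm.toMonoidHom := by
    ext s
    simp [θ]
  have hθ_inr : θ.comp (FreeGroup.map Sum.inr) = K.subtype.comp c.repr.symm.toMonoidHom := by
    ext s
    simp [θ]
  have hθη : θ.comp η = Monoid.Coprod.lift H.subtype K.subtype := by
    refine Monoid.Coprod.hom_ext ?_ ?_
    · ext x
      simpa [η] using DFunLike.congr_fun hθ_inl (b.repr x)
    · ext x
      simpa [η] using DFunLike.congr_fun hθ_inr (c.repr x)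
  have hη_of : ∀ s, η (e.symm (θ (.of s))) = .of s := by
    rintro (s | s)
    · have : θ (.of (.inl s)) = e (Monoid.Coprod.inl (b.repr.symm (.of s))) := by simp [θ, e]
      rw [this, e.symm_apply_apply]
      simp [η]
    · have : θ (.of (.inr s)) = e (Monoid.Coprod.inr (c.repr.symm (.of s))) := by simp [θ, e]
      rw [this, e.symm_apply_apply]
      simp [η]
  have hηθ : (η.comp e.symm.toMonoidHom).comp θ = MonoidHom.id _ :=
    FreeGroup.ext_hom _ _ hη_of
  have hθ_inj : Function.Injective θ :=
    Function.LeftInverse.injective (g := fun x => η (e.symm x)) fun x => DFunLike.congr_fun hηθ x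
  have hθ_surj : Function.Surjective θ := fun x => by
    obtain ⟨y, rfl⟩ := hK.2 x
    exact ⟨η y, DFunLike.congr_fun hθη y⟩
  have hH : H = (Subgroup.closure (FreeGroup.of '' Set.range (Sum.inl (β := τ)))).map θ := by
    rw [← FreeGroup.range_map, ← MonoidHom.range_comp, hθ_inl, MonoidHom.range_comp,
      MonoidHom.range_eq_top.2 b.repr.symm.surjective, ← MonoidHom.range_eq_map,
      Subgroup.range_subtype]
  obtain ⟨f, rfl⟩ := hθ_surj f
  obtain ⟨h, rfl⟩ := hθ_surj h
  rw [← map_inv, ← map_mul, ← map_mul] at hf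
  rw [hH, Subgroup.mem_map_iff_mem hθ_inj] at hh hf ⊢
  exact FreeGroup.mem_closure_of_conj_mem_closure (by rintro rfl; exact h_ne (map_one θ)) hh hf

namespace HNNExtension

variable {G : Type*} [Group G] {A B : Subgroup G} {φ : A ≃* B}

open NormalWord

/-- The word `t ^ u₁ * g₁ * ⋯ * t ^ uₙ * gₙ`. -/
def tailProd (φ : A ≃* B) (l : List (ℤˣ × G)) : HNNExtension G A B φ :=
  (l.map fun x => t ^ (x.1 : ℤ) * of x.2).prod

/-- If `g * t ^ u * ⋯` is a reduced word conjugating an element `x` of the base group into the base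
group, then the conjugate of `x` by `g` lies in the associated subgroup. -/
theorem conj_mem_toSubgroup_of_isReduced {g x z a : G} {u : ℤˣ} {l : List (ℤˣ × G)}
    (hl : ((u, a) :: l).IsChain fun a b => a.2 ∈ toSubgroup A B a.1 → a.1 = b.1)
    (h : of x * (of g * tailProd φ ((u, a) :: l)) = of g * tailProd φ ((u, a) :: l) * of z) :
    g⁻¹ * x * g ∈ toSubgroup A B (-u) := by
  obtain ⟨m, ⟨v, b⟩, hm⟩ := (List.eq_nil_or_concat ((u, a) :: l)).resolve_left (by simp)
  rw [List.concat_eq_append] at hm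
  have hchain : (m ++ [(v, b * z)]).IsChain fun a b => a.2 ∈ toSubgroup A B a.1 → a.1 = b.1 := by
    rw [hm] at hl
    rw [List.isChain_append] at hl ⊢
    exact ⟨hl.1, List.isChain_singleton _, by simpa using hl.2.2⟩
  have hprod : tailProd φ (m ++ [(v, b * z)]) = tailProd φ ((u, a) :: l) * of z := by
    rw [hm]
    simp [tailProd, mul_assoc]
  let w₁ : ReducedWord G A B := ⟨g, m ++ [(v, b * z)], hchain⟩
  let w₂ : ReducedWord G A B := ⟨x * g, (u, a) :: l, hl⟩
  have hw : w₁.prod φ = w₂.prod φ := by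
    change of g * tailProd φ _ = of (x * g) * tailProd φ _
    rw [hprod, ← mul_assoc, ← h, map_mul, mul_assoc]
  have hfst : w₁.toList.map Prod.fst = u :: l.map Prod.fst :=
    (ReducedWord.map_fst_eq_and_of_prod_eq φ hw).1
  have := (ReducedWord.map_fst_eq_and_of_prod_eq φ hw).2 u (by
    rw [← List.head?_map, hfst]; rfl)
  simpa [w₁, w₂, mul_assoc] using this

/-- Let `A` be malnormal in `G` and meet all conjugates of `B` trivially. Then an element of the
HNN extension which conjugates a nontrivial element of `A` into `A` is of the form
`t⁻¹ * f * t * b` with `b ∈ A`. -/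
theorem exists_eq_of_conj_mem
    (hA : ∀ f x : G, x ≠ 1 → x ∈ A → f⁻¹ * x * f ∈ A → f ∈ A)
    (hAB : ∀ f x : G, x ∈ A → f⁻¹ * x * f ∈ B → x = 1)
    (x : A) (hx : x ≠ 1) {z : G} (hz : z ∈ A) {w : HNNExtension G A B φ}
    (h : of (x : G) * w = w * of z) :
    ∃ f b : G, b ∈ A ∧ w = t⁻¹ * of f * t * of b ∧ f⁻¹ * φ x * f ∈ B := by
  have hBA (f x : G) (hxB : x ∈ B) (hxA : f⁻¹ * x * f ∈ A) : x = 1 := by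
    have := hAB f⁻¹ _ hxA (by simpa [mul_assoc] using hxB)
    simpa [mul_assoc, inv_mul_eq_one] using this
  have hA_mem {a : G} (ha : a ∈ A) : (of a : HNNExtension G A B φ) =
      t⁻¹ * of (φ ⟨a, ha⟩ : G) * t := by
    rw [mul_assoc, ← t_mul_of]; simp
  have hx' : (x : G) ≠ 1 := by simpa using hx
  have hφx : (φ x : G) ≠ 1 := by simpa using hx
  have hend {g y : G} (h : (of y : HNNExtension G A B φ) * (of g * tailProd φ []) =
      of g * tailProd φ [] * of z) : g⁻¹ * y * g = z := by
    have : y * g = g * z := of_injective (φ := φ) (by simpa [tailProd] using h)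
    rw [mul_assoc, this, inv_mul_cancel_left]
  obtain ⟨d⟩ := TransversalPair.nonempty G A B
  obtain ⟨⟨g, l, hl⟩, rfl⟩ : ∃ r : ReducedWord G A B, r.prod φ = w :=
    ⟨_, (NormalWord.equiv φ d).symm_apply_apply w⟩
  change of (x : G) * (of g * tailProd φ l) = of g * tailProd φ l * of z at h
  change ∃ f b : G, b ∈ A ∧ of g * tailProd φ l = _ ∧ _
  have hcons (u : ℤˣ) (a : G) (l : List (ℤˣ × G)) :
      tailProd φ ((u, a) :: l) = t ^ (u : ℤ) * (of a * tailProd φ l) := by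
    simp [tailProd, mul_assoc]
  -- Conjugating past `g * t⁻¹` and past `g * t`, respectively.
  have hpast_inv {g y : G} {W : HNNExtension G A B φ} (hy : g⁻¹ * y * g ∈ A)
      (h : of y * (of g * (t⁻¹ * W)) = of g * (t⁻¹ * W) * of z) :
      of (φ ⟨_, hy⟩ : G) * W = W * of z := by
    rw [equiv_eq_conj]
    have h₂ : W * of z = t * (of g)⁻¹ * (of g * (t⁻¹ * W) * of z) := by group
    rw [h₂, ← h]
    simp [mul_assoc]
  have hpast {g y : G} {W : HNNExtension G A B φ} (hy : g⁻¹ * y * g ∈ B)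
      (h : of y * (of g * (t * W)) = of g * (t * W) * of z) :
      of (φ.symm ⟨_, hy⟩ : G) * W = W * of z := by
    rw [equiv_symm_eq_conj]
    have h₂ : W * of z = t⁻¹ * (of g)⁻¹ * (of g * (t * W) * of z) := by group
    rw [h₂, ← h]
    simp [mul_assoc]
  rcases l with _ | ⟨⟨u, g₁⟩, l⟩
  · have hg : g ∈ A := hA g x hx' x.2 (by rwa [hend h])
    exact ⟨1, g, hg, by simp [tailProd], by simp⟩
  have hpinch := conj_mem_toSubgroup_of_isReduced hl h
  rcases Int.units_eq_one_or u with rfl | rfl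
  · exact absurd (hAB g x x.2 hpinch) hx'
  rw [neg_neg, toSubgroup_one] at hpinch
  have hg : g ∈ A := hA g x hx' x.2 hpinch
  have h₁ := hpast_inv hpinch (by simpa [hcons] using h)
  set x₁ := φ ⟨_, hpinch⟩ with hx₁_def
  have hx₁ : (x₁ : G) ≠ 1 := by
    intro h₁
    have : g⁻¹ * x * g = 1 := by simpa [hx₁_def, Subtype.ext_iff] using h₁
    exact hx (by simpa [mul_assoc, inv_mul_eq_one] using this)
  have hx₁_eq : (x₁ : G) = (φ ⟨g, hg⟩ : G)⁻¹ * φ x * φ ⟨g, hg⟩ := by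
    have : (⟨_, hpinch⟩ : A) = ⟨g, hg⟩⁻¹ * x * ⟨g, hg⟩ := rfl
    rw [hx₁_def, this]; simp
  rcases l with _ | ⟨⟨v, g₂⟩, l⟩
  · exact absurd (hBA g₁ x₁ x₁.2 (by rwa [hend h₁])) hx₁
  have hl' := hl.tail
  have hpinch₁ := conj_mem_toSubgroup_of_isReduced hl' h₁
  rcases Int.units_eq_one_or v with rfl | rfl
  swap
  · exact absurd (hBA g₁ x₁ x₁.2 (by simpa using hpinch₁)) hx₁
  rw [toSubgroup_neg_one] at hpinch₁
  have h₂ := hpast hpinch₁ (by simpa [hcons] using h₁)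
  set x₂ := φ.symm ⟨_, hpinch₁⟩ with hx₂_def
  have hx₂ : (x₂ : G) ≠ 1 := by
    intro h₂
    have : g₁⁻¹ * x₁ * g₁ = 1 := by simpa [hx₂_def, Subtype.ext_iff] using h₂
    exact hx₁ (by simpa [mul_assoc, inv_mul_eq_one] using this)
  rcases l with _ | ⟨⟨v', g₃⟩, l⟩
  · have hg₂ : g₂ ∈ A := hA g₂ x₂ hx₂ x₂.2 (by rwa [hend h₂])
    refine ⟨φ ⟨g, hg⟩ * g₁, g₂, hg₂, ?_, ?_⟩
    · rw [hA_mem hg]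
      simp [tailProd, mul_assoc]
    · rw [hx₁_eq] at hpinch₁
      simpa [mul_assoc] using hpinch₁
  have hpinch₂ := conj_mem_toSubgroup_of_isReduced hl'.tail h₂
  rcases Int.units_eq_one_or v' with rfl | rfl
  · exact absurd (hAB g₂ x₂ x₂.2 hpinch₂) hx₂
  · have hg₂ : g₂ ∈ A := hA g₂ x₂ hx₂ x₂.2 (by simpa using hpinch₂)
    have := (List.isChain_cons_cons.1 hl').1 hg₂
    exact absurd this (by simp)

end HNNExtension

/-- **Theorem 1.1 + Theorem 1.3 (group-theoretic form).** Let `H` be a proper free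
factor of a finitely generated free group `F` and `Ψ : H → F` a monomorphism whose
image meets every conjugate of `H` trivially. Then the image `H̄` of `H` in the HNN
extension `G` of `F` associating `H` to `Ψ(H)` has finite height in `G`. -/
theorem finiteHeight_of_malnormal_image {ι : Type} [Finite ι]
    (H : Subgroup (FreeGroup ι)) (hH : IsProperFreeFactor H)
    (Ψ : ↥H →* FreeGroup ι) (hΨ : Function.Injective Ψ)
    (hmal : ∀ g : FreeGroup ι,
      Ψ.range ⊓ H.map ((MulAut.conj g⁻¹).toMonoidHom) = ⊥) :
    HasFiniteHeight (H.map (HNNExtension.of : FreeGroup ι →*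
        HNNExtension (FreeGroup ι) H Ψ.range (MonoidHom.ofInjective hΨ))) := by
  have : Group.FG H := hH.fg
  have hFG : Ψ.range.FG :=
    (Group.fg_iff_subgroup_fg _).1 (Group.fg_of_surjective Ψ.rangeRestrict_surjective)
  obtain ⟨N, hN⟩ := FreeGroup.exists_card_le_of_conj_mem hFG
  have hA (f x : FreeGroup ι) (hx : x ≠ 1) (hxH : x ∈ H) (hf : f⁻¹ * x * f ∈ H) : f ∈ H :=
    inv_mem_iff.1 (hH.mem_of_conj_mem hx hxH (by simpa using hf))
  have hAB (f x : FreeGroup ι) (hxH : x ∈ H) (hf : f⁻¹ * x * f ∈ Ψ.range) : x = 1 := by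
    have : f⁻¹ * x * f ∈ Ψ.range ⊓ H.map ((MulAut.conj f⁻¹).toMonoidHom) :=
      ⟨hf, x, hxH, by simp⟩
    rw [hmal, Subgroup.mem_bot] at this
    simpa [mul_assoc, inv_mul_eq_one] using this
  refine ⟨N, fun k g hg hinf => ?_⟩
  rcases k with _ | k
  · exact Nat.zero_le N
  obtain ⟨y, hy, hy_ne⟩ := hinf.exists_notMem_finset {1}
  have hy' (i) : ∃ z ∈ H, g i * y * (g i)⁻¹ = HNNExtension.of z := by
    obtain ⟨_, ⟨z, hz, rfl⟩, hzy⟩ := Subgroup.mem_iInf.1 hy i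
    refine ⟨z, hz, ?_⟩
    rw [← hzy]
    simp [mul_assoc]
  choose z hz hyz using hy'
  have hz_ne : (⟨z 0, hz 0⟩ : H) ≠ 1 := by
    intro h
    have h0 : z 0 = 1 := congrArg Subtype.val h
    have := hyz 0
    rw [h0, map_one, mul_inv_eq_one, mul_eq_left] at this
    exact hy_ne (by simpa using this)
  have hconj (i) : HNNExtension.of (z 0) * (g 0 * (g i)⁻¹) =
      g 0 * (g i)⁻¹ * HNNExtension.of (z i) := by
    rw [← hyz, ← hyz]; group
  choose f b hb hgf hf using fun i =>
    HNNExtension.exists_eq_of_conj_mem hA hAB ⟨z 0, hz 0⟩ hz_ne (hz i) (hconj i)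
  refine hN (MonoidHom.ofInjective hΨ ⟨z 0, hz 0⟩) (by simpa using hz_ne) (k + 1)
    (fun i => (f i)⁻¹) (fun i => by simpa using hf i) fun i j hij => hg i j ?_
  have hij' : (f i)⁻¹ * f j ∈ Ψ.range := by simpa using hij
  have key : g i * (g j)⁻¹ = (g 0 * (g i)⁻¹)⁻¹ * (g 0 * (g j)⁻¹) := by group
  refine ⟨(b i)⁻¹ * ((MonoidHom.ofInjective hΨ).symm ⟨_, hij'⟩ : H) * b j,
    mul_mem (mul_mem (inv_mem (hb i)) (SetLike.coe_mem _)) (hb j), ?_⟩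
  rw [key, hgf, hgf, map_mul, map_mul, HNNExtension.equiv_symm_eq_conj]
  simp [mul_assoc]
end

section
/- Let F be a finitely generated free group, H a proper free factor of F, and Ψ : H → F an injective group homomorphism that is fully irreducible. Let G be the HNN extension of F associating H to Ψ(H), i.e. G = HNNExtension F H Ψ.range φ where φ : H ≃* Ψ.range is the isomorphism induced by Ψ. Then G is coherent: every finitely generated subgroup of G is finitely presented, i.e. isomorphic to a presented group (quotient of a free group on a finite type by the normal closure of a finite set of relators). -/
/-- The rational group ring of the free group on `X`. -/
abbrev FreeGroupRing (X : Type*) := MonoidAlgebra ℚ (FreeGroup X)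

namespace FreeGroupRing

variable {X : Type*}

/-- Group elements inside the group ring. -/
noncomputable def of : FreeGroup X →* FreeGroupRing X := MonoidAlgebra.of ℚ _

theorem ring_induction {p : FreeGroupRing X → Prop} (f : FreeGroupRing X) (of : ∀ g, p (of g))
    (add : ∀ a b, p a → p b → p (a + b)) (smul : ∀ (r : ℚ) a, p a → p (r • a)) : p f :=
  MonoidAlgebra.induction_on f of add smul

/-- The augmentation of the group ring. -/
noncomputable def aug : FreeGroupRing X →ₐ[ℚ] ℚ := MonoidAlgebra.lift ℚ ℚ (FreeGroup X) 1

theorem aug_of (g : FreeGroup X) : aug (of g) = 1 := by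
  simp [aug, of]

/-- The affine action of a free generator on the free module over the group ring. -/
noncomputable def foxPerm (c : X) : Equiv.Perm (X →₀ FreeGroupRing X) where
  toFun m := of (FreeGroup.of c) • m + Finsupp.single c 1
  invFun m := of (FreeGroup.of c)⁻¹ • (m - Finsupp.single c 1)
  left_inv m := by
    simp only [add_sub_cancel_right, smul_smul]
    rw [← map_mul, inv_mul_cancel, map_one, one_smul]
  right_inv m := by
    simp only [smul_smul]
    rw [← map_mul, mul_inv_cancel, map_one, one_smul, sub_add_cancel]

/-- The total Fox derivative on group elements. -/
noncomputable def foxGroup (g : FreeGroup X) : X →₀ FreeGroupRing X :=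
  FreeGroup.lift foxPerm g 0

theorem lift_foxPerm_apply (g : FreeGroup X) (m : X →₀ FreeGroupRing X) :
    FreeGroup.lift foxPerm g m = of g • m + foxGroup g := by
  induction g using FreeGroup.induction_on generalizing m with
  | C1 => simp [foxGroup]
  | of x => simp [foxGroup, foxPerm]
  | inv_of x _ =>
    have : ∀ m : X →₀ FreeGroupRing X, (foxPerm x)⁻¹ m =
      of (FreeGroup.of x)⁻¹ • (m - Finsupp.single x 1) := fun m => rfl
    simp only [foxGroup, map_inv, FreeGroup.lift_apply_of, this, smul_sub, smul_zero]
    abel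
  | mul x y hx hy =>
    simp only [foxGroup, map_mul, Equiv.Perm.mul_apply] at *
    rw [hy, hx, hx (FreeGroup.lift foxPerm y 0)]
    simp only [smul_add, mul_smul]
    abel

theorem foxGroup_mul (g h : FreeGroup X) : foxGroup (g * h) = of g • foxGroup h + foxGroup g := by
  rw [← lift_foxPerm_apply, foxGroup, map_mul]; rfl

theorem foxGroup_of (c : X) : foxGroup (FreeGroup.of c) = Finsupp.single c 1 := by
  simp [foxGroup, foxPerm]

theorem foxGroup_one : foxGroup (1 : FreeGroup X) = 0 := by
  simp [foxGroup]

theorem foxGroup_inv (g : FreeGroup X) : foxGroup g⁻¹ = - (of g⁻¹ • foxGroup g) := by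
  have := foxGroup_mul g⁻¹ g
  rw [inv_mul_cancel, foxGroup_one] at this
  exact eq_neg_of_add_eq_zero_right this.symm

/-- The total Fox derivative on the group ring. -/
noncomputable def fox : FreeGroupRing X →ₗ[ℚ] X →₀ FreeGroupRing X where
  toFun f := Finsupp.linearCombination ℚ foxGroup f.coeff
  map_add' f g := by simp
  map_smul' r f := by simp

theorem fox_of (g : FreeGroup X) : fox (of g) = foxGroup g := by
  simp [fox, of]

theorem fox_mul (f g : FreeGroupRing X) : fox (f * g) = aug g • fox f + f • fox g := by
  induction f using ring_induction with
  | of x =>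
    induction g using ring_induction with
    | of y => rw [← map_mul, fox_of, fox_of, fox_of, foxGroup_mul, aug_of, one_smul, add_comm]
    | add a b ha hb =>
      rw [mul_add, map_add, ha, hb, map_add, map_add, add_smul, smul_add]; abel
    | smul r a ha =>
      rw [mul_smul_comm, map_smul, ha, map_smul, map_smul, smul_add, smul_assoc,
        smul_comm r _ (fox a)]
  | add a b ha hb => rw [add_mul, map_add, ha, hb, map_add, add_smul, smul_add]; abel
  | smul r a ha =>
    rw [smul_mul_assoc, map_smul, ha, map_smul, smul_add, smul_assoc, smul_comm]

theorem fox_one : fox (1 : FreeGroupRing X) = 0 := by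
  have := fox_of (1 : FreeGroup X)
  rwa [foxGroup_one, of, map_one] at this

theorem sub_aug_eq_linearCombination (f : FreeGroupRing X) :
    f - algebraMap ℚ _ (aug f) =
      Finsupp.linearCombination (FreeGroupRing X) (fun c => of (FreeGroup.of c) - 1) (fox f) := by
  induction f using ring_induction with
  | of g =>
    rw [aug_of, map_one, fox_of]
    induction g using FreeGroup.induction_on with
    | C1 => simp [foxGroup_one]
    | of x => simp [foxGroup_of]
    | inv_of x _ =>
      rw [foxGroup_inv, foxGroup_of]
      simp only [map_neg, map_smul, Finsupp.linearCombination_single, mul_sub, smul_eq_mul,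
        one_mul, mul_one, ← map_mul, inv_mul_cancel, map_one, neg_sub]
    | mul x y hx hy =>
      rw [foxGroup_mul, map_add, map_smul, ← hx, ← hy, map_mul, smul_eq_mul, mul_sub]; simp
  | add a b ha hb => rw [map_add, map_add, map_add, map_add, ← ha, ← hb]; abel
  | smul r a ha =>
    rw [map_smul aug, map_smul fox, smul_eq_mul, map_mul, LinearMap.map_smul_of_tower, ← ha,
      smul_sub, Algebra.smul_def r (algebraMap _ _ _)]

/-- The powers of the augmentation ideal, described through Fox derivatives. -/
noncomputable def augFil : ℕ → Ideal (FreeGroupRing X)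
  | 0 => ⊤
  | n + 1 =>
    { carrier := {f | aug f = 0 ∧ ∀ c, fox f c ∈ augFil n}
      add_mem' := fun {f g} hf hg => ⟨by rw [map_add, hf.1, hg.1, add_zero], fun c => by
        rw [map_add]; exact add_mem (hf.2 c) (hg.2 c)⟩
      zero_mem' := ⟨map_zero _, fun c => by rw [map_zero]; exact zero_mem _⟩
      smul_mem' := fun r f hf => ⟨by rw [smul_eq_mul, map_mul, hf.1, mul_zero], fun c => by
        rw [smul_eq_mul, fox_mul, hf.1, zero_smul, zero_add]
        exact Ideal.mul_mem_left _ r (hf.2 c)⟩ }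

theorem mem_augFil_zero (f : FreeGroupRing X) : f ∈ augFil 0 := Submodule.mem_top

theorem augFil_succ_le (n : ℕ) : augFil (X := X) (n + 1) ≤ augFil n := by
  induction n with
  | zero => exact le_top
  | succ n ih => exact fun f hf => ⟨hf.1, fun c => ih (hf.2 c)⟩

theorem augFil_antitone : Antitone (augFil (X := X)) := antitone_nat_of_succ_le augFil_succ_le

theorem mul_mem_augFil_right {n : ℕ} {f : FreeGroupRing X} (hf : f ∈ augFil n)
    (g : FreeGroupRing X) : f * g ∈ augFil n := by
  induction n generalizing f g with
  | zero => exact mem_augFil_zero _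
  | succ n ih =>
    refine ⟨by rw [map_mul, hf.1, zero_mul], fun c => ?_⟩
    rw [fox_mul]
    exact add_mem (Submodule.smul_of_tower_mem _ _ (hf.2 c)) (ih (augFil_succ_le n hf) _)

theorem mul_mem_augFil_succ {n : ℕ} {f g : FreeGroupRing X} (hf : f ∈ augFil n)
    (hg : aug g = 0) : f * g ∈ augFil (n + 1) := by
  refine ⟨by rw [map_mul, hg, mul_zero], fun c => ?_⟩
  rw [fox_mul, hg, zero_smul, zero_add]
  exact mul_mem_augFil_right hf _

theorem exists_one_sub_mul_mem_augFil {γ : FreeGroupRing X} (hγ : aug γ ≠ 0) (n : ℕ) :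
    ∃ u, 1 - γ * u ∈ augFil n := by
  induction n with
  | zero => exact ⟨0, mem_augFil_zero _⟩
  | succ n ih =>
    obtain ⟨u, hu⟩ := ih
    refine ⟨u + (1 - u * γ) * algebraMap ℚ _ (aug γ)⁻¹, ?_⟩
    have : 1 - γ * (u + (1 - u * γ) * algebraMap ℚ _ (aug γ)⁻¹) =
        (1 - γ * u) * (1 - γ * algebraMap ℚ _ (aug γ)⁻¹) := by noncomm_ring
    rw [this]
    refine mul_mem_augFil_succ hu ?_
    rw [map_sub, map_mul, AlgHom.commutes, map_one]
    simp [hγ]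

/-- The span of the group elements of word length at most `n`. -/
noncomputable def wordSpan (X : Type*) (n : ℕ) : Submodule ℚ (FreeGroupRing X) :=
  Submodule.span ℚ {f | ∃ L : List (X × Bool), L.length ≤ n ∧ of (FreeGroup.mk L) = f}

theorem of_mk_mem_wordSpan {n : ℕ} {L : List (X × Bool)} (h : L.length ≤ n) :
    of (FreeGroup.mk L) ∈ wordSpan X n := Submodule.subset_span ⟨L, h, rfl⟩

theorem wordSpan_mono : Monotone (wordSpan X) := fun _ _ h =>
  Submodule.span_mono fun _ ⟨L, hL, e⟩ => ⟨L, hL.trans h, e⟩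

theorem exists_mem_wordSpan (f : FreeGroupRing X) : ∃ n, f ∈ wordSpan X n := by
  induction f using ring_induction with
  | of g =>
    obtain ⟨L, rfl⟩ := Quot.exists_rep g
    exact ⟨_, of_mk_mem_wordSpan le_rfl⟩
  | add a b ha hb =>
    obtain ⟨n, hn⟩ := ha
    obtain ⟨m, hm⟩ := hb
    exact ⟨max n m, add_mem (wordSpan_mono (le_max_left _ _) hn)
      (wordSpan_mono (le_max_right _ _) hm)⟩
  | smul r a ha => exact ha.imp fun n hn => Submodule.smul_mem _ _ hn

theorem foxGroup_mk_singleton [DecidableEq X] (x : X × Bool) (c : X) :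
    foxGroup (FreeGroup.mk [x]) c =
      (if x.1 = c then (if x.2 then 1 else - of (FreeGroup.mk [x])) else 0 : FreeGroupRing X) := by
  obtain ⟨x, b⟩ := x
  cases b
  · have : FreeGroup.mk [(x, false)] = (FreeGroup.of x)⁻¹ := rfl
    rw [this, foxGroup_inv, foxGroup_of]
    by_cases h : x = c <;> simp [h]
  · have : FreeGroup.mk [(x, true)] = FreeGroup.of x := rfl
    rw [this, foxGroup_of]
    by_cases h : x = c <;> simp [h]

theorem of_mk_singleton_mul_mem {n : ℕ} (x : X × Bool) {f : FreeGroupRing X}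
    (hf : f ∈ wordSpan X n) : of (FreeGroup.mk [x]) * f ∈ wordSpan X (n + 1) := by
  refine Submodule.span_induction ?_ ?_ ?_ ?_ hf
  · rintro _ ⟨L, hL, rfl⟩
    rw [← map_mul, FreeGroup.mul_mk]
    exact of_mk_mem_wordSpan (by simpa using hL)
  · simp
  · intro a b _ _ ha hb
    rw [mul_add]; exact add_mem ha hb
  · intro r a _ ha
    rw [mul_smul_comm]; exact Submodule.smul_mem _ _ ha

theorem foxGroup_mk_mem (L : List (X × Bool)) (c : X) :
    foxGroup (FreeGroup.mk L) c ∈ wordSpan X L.length := by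
  classical
  induction L with
  | nil => rw [← FreeGroup.one_eq_mk, foxGroup_one]; exact zero_mem _
  | cons x L ih =>
    rw [show FreeGroup.mk (x :: L) = FreeGroup.mk [x] * FreeGroup.mk L from by simp, foxGroup_mul]
    refine add_mem (of_mk_singleton_mul_mem x ih) ?_
    rw [foxGroup_mk_singleton]
    split_ifs
    · exact of_mk_mem_wordSpan (L := []) (by simp)
    · exact neg_mem (of_mk_mem_wordSpan (by simp))
    · exact zero_mem _

theorem fox_mem_wordSpan {n : ℕ} {f : FreeGroupRing X} (hf : f ∈ wordSpan X n) (c : X) :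
    fox f c ∈ wordSpan X n := by
  refine Submodule.span_induction ?_ ?_ ?_ ?_ hf
  · rintro _ ⟨L, hL, rfl⟩
    rw [fox_of]
    exact wordSpan_mono hL (foxGroup_mk_mem L c)
  · simp
  · intro a b _ _ ha hb
    rw [map_add]; exact add_mem ha hb
  · intro r a _ ha
    rw [map_smul]; exact Submodule.smul_mem _ _ ha

theorem fox_fox_mem_wordSpan [DecidableEq X] {n : ℕ} {f : FreeGroupRing X}
    (hf : f ∈ wordSpan X (n + 1)) (c c' : X) :
    fox (fox f c) c' + (if c' = c then fox f c else 0) ∈ wordSpan X n := by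
  refine Submodule.span_induction ?_ ?_ ?_ ?_ hf
  · rintro _ ⟨L, hL, rfl⟩
    rw [fox_of]
    rcases List.eq_nil_or_concat L with rfl | ⟨L, x, rfl⟩
    · simp [← FreeGroup.one_eq_mk, foxGroup_one]
    have hL' : L.length ≤ n := by simpa using hL
    rw [List.concat_eq_append, ← FreeGroup.mul_mk, foxGroup_mul, Finsupp.add_apply,
      Finsupp.smul_apply, foxGroup_mk_singleton, map_add]
    have h0 : of (FreeGroup.mk L) ∈ wordSpan X n := of_mk_mem_wordSpan hL'
    have h1 : foxGroup (FreeGroup.mk L) c ∈ wordSpan X n :=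
      wordSpan_mono hL' (foxGroup_mk_mem L c)
    have h2 := fox_mem_wordSpan h1 c'
    have h3 : foxGroup (FreeGroup.mk L) c' ∈ wordSpan X n :=
      wordSpan_mono hL' (foxGroup_mk_mem L c')
    split_ifs with hx hb hc hc hc
    · rw [smul_eq_mul, mul_one, fox_of]
      exact add_mem (add_mem h3 h2) (add_mem h0 h1)
    · rw [smul_eq_mul, mul_one, fox_of]
      exact add_mem (add_mem h3 h2) (zero_mem _)
    · subst hc
      rw [smul_neg, smul_eq_mul, ← map_mul, map_neg, fox_of, foxGroup_mul, Finsupp.add_apply,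
        Finsupp.neg_apply, Finsupp.add_apply, Finsupp.smul_apply, foxGroup_mk_singleton,
        if_pos hx, if_neg hb]
      convert h2 using 1
      rw [map_mul, smul_neg, smul_eq_mul]
      abel
    · rw [smul_neg, smul_eq_mul, ← map_mul, map_neg, fox_of, foxGroup_mul, Finsupp.add_apply,
        Finsupp.neg_apply, Finsupp.add_apply, Finsupp.smul_apply, foxGroup_mk_singleton,
        if_neg (fun h => hc (h.symm.trans hx)), smul_zero, zero_add, add_zero]
      exact add_mem (neg_mem h3) h2
    · simpa using add_mem h2 h1
    · simpa using h2
  · simp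
  · intro a b _ _ ha hb
    convert add_mem ha hb using 1
    split_ifs <;> simp only [map_add, Finsupp.add_apply] <;> abel
  · intro r a _ ha
    convert Submodule.smul_mem _ r ha using 1
    split_ifs <;> simp

theorem fox_eq_zero_iff {f : FreeGroupRing X} (h : aug f = 0) (h' : fox f = 0) : f = 0 := by
  have := sub_aug_eq_linearCombination f
  rwa [h, h', map_zero, map_zero, sub_zero] at this

/-- **Magnus**: the powers of the augmentation ideal intersect trivially. -/
theorem eq_zero_of_forall_mem_augFil {f : FreeGroupRing X} (h : ∀ n, f ∈ augFil n) : f = 0 := by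
  classical
  obtain ⟨n, hn⟩ := exists_mem_wordSpan f
  have hfox : ∀ g : FreeGroupRing X, (∀ n, g ∈ augFil n) → ∀ c n, fox g c ∈ augFil n :=
    fun g hg c n => (hg (n + 1)).2 c
  induction n generalizing f with
  | zero =>
    have h1 : wordSpan X 0 ≤ Submodule.span ℚ {1} := Submodule.span_mono (by
      rintro _ ⟨L, hL, rfl⟩
      rw [List.length_eq_zero_iff.1 (Nat.le_zero.1 hL), ← FreeGroup.one_eq_mk, map_one]
      rfl)
    obtain ⟨r, rfl⟩ := Submodule.mem_span_singleton.1 (h1 hn)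
    have : r = 0 := by simpa using (h 1).1
    rw [this, zero_smul]
  | succ n ih =>
    refine fox_eq_zero_iff (h 1).1 (Finsupp.ext fun c => ?_)
    have hc := hfox f h c
    have key : fox (fox f c) = Finsupp.single c (- fox f c) := by
      ext1 c'
      have := ih (f := fox (fox f c) c' + (if c' = c then fox f c else 0))
        (fun n => add_mem (hfox _ hc c' n) (by split_ifs; exacts [hc n, zero_mem _]))
        (fox_fox_mem_wordSpan hn c c')
      rw [eq_neg_of_add_eq_zero_left this, Finsupp.single_apply]
      by_cases h : c' = c
      · simp [h]
      · simp [h, Ne.symm h]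
    have h2 := sub_aug_eq_linearCombination (fox f c)
    rw [(hc 1).1, map_zero, sub_zero, key, Finsupp.linearCombination_single, smul_eq_mul, neg_mul,
      mul_sub, mul_one, neg_sub, eq_sub_iff_add_eq, add_eq_left] at h2
    have h3 := congrArg (· * of (FreeGroup.of c)⁻¹) h2
    simpa [mul_assoc, ← map_mul] using h3

theorem exists_aug_ne_zero_of_sum_mul {ι κ : Type*} {A : ι → κ → FreeGroupRing X} {s : Set ι}
    {t : Finset κ} {j₀ : ι} {v M : ℕ} {β : κ → FreeGroupRing X} (hv : v ≤ M)
    (hs : ∀ j ∈ s, ∑ a ∈ t, A j a * β a ∈ augFil M) (h₀ : ∑ a ∈ t, A j₀ a * β a ∉ augFil v) :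
    ∃ γ : κ → FreeGroupRing X, ∃ a ∈ t, aug (γ a) ≠ 0 ∧
      ∀ j ∈ s, ∑ a ∈ t, A j a * γ a ∈ augFil (M - v) := by
  induction v generalizing M β with
  | zero => exact absurd (mem_augFil_zero _) h₀
  | succ v ih =>
    by_cases hβ : ∃ a ∈ t, aug (β a) ≠ 0
    · obtain ⟨a, ha, hne⟩ := hβ
      exact ⟨β, a, ha, hne, fun j hj => augFil_antitone (Nat.sub_le _ _) (hs j hj)⟩
    push Not at hβ
    have hfox : ∀ j c, fox (∑ a ∈ t, A j a * β a) c = ∑ a ∈ t, A j a * fox (β a) c := by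
      intro j c
      rw [map_sum, Finsupp.finsetSum_apply]
      refine Finset.sum_congr rfl fun a ha => ?_
      rw [fox_mul, hβ a ha, zero_smul, zero_add, Finsupp.smul_apply, smul_eq_mul]
    have haug : aug (∑ a ∈ t, A j₀ a * β a) = 0 := by
      rw [map_sum]
      exact Finset.sum_eq_zero fun a ha => by rw [map_mul, hβ a ha, mul_zero]
    have : ∃ c, ∑ a ∈ t, A j₀ a * fox (β a) c ∉ augFil v := by
      by_contra! hcon
      exact h₀ ⟨haug, fun c => by rw [hfox]; exact hcon c⟩
    obtain ⟨c, hc⟩ := this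
    obtain ⟨M, rfl⟩ : ∃ M', M = M' + 1 := ⟨M - 1, by omega⟩
    rw [Nat.add_sub_add_right]
    exact ih (Nat.le_of_succ_le_succ hv) (fun j hj => by rw [← hfox]; exact (hs j hj).2 c) hc

theorem card_le_of_triangular_mod_augFil {ι κ : Type*} [LinearOrder ι]
    {A : ι → κ → FreeGroupRing X} {v : ι → ℕ} {s : Finset ι} {t : Finset κ}
    {B : κ → ι → FreeGroupRing X} {M : ℕ} (hM : ∑ i ∈ s, v i ≤ M)
    (hlow : ∀ j ∈ s, ∀ k ∈ s, k < j → ∑ a ∈ t, A j a * B a k ∈ augFil M)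
    (hdiag : ∀ j ∈ s, ∑ a ∈ t, A j a * B a j ∉ augFil (v j)) : s.card ≤ t.card := by
  classical
  induction s using Finset.induction_on_min generalizing t B M with
  | empty => simp
  | insert j₀ s hj₀ ih =>
    have hnot : j₀ ∉ s := fun h => lt_irrefl _ (hj₀ _ h)
    rw [Finset.sum_insert hnot] at hM
    obtain ⟨γ, a₀, ha₀, hne, hγ⟩ := exists_aug_ne_zero_of_sum_mul (s := (s : Set ι)) (t := t)
      (A := A) (j₀ := j₀) (v := v j₀) (M := M) (β := fun a => B a j₀) (by omega)
      (fun j hj => hlow j (Finset.mem_insert_of_mem hj) j₀ (Finset.mem_insert_self _ _) (hj₀ j hj))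
      (hdiag j₀ (Finset.mem_insert_self _ _))
    obtain ⟨u, hu⟩ := exists_one_sub_mul_mem_augFil hne (M - v j₀)
    rw [Finset.card_insert_of_notMem hnot]
    have key : ∀ j ∈ s, ∀ k, ∑ a ∈ t, A j a * B a k -
        ∑ a ∈ t.erase a₀, A j a * (B a k - γ a * (u * B a₀ k)) ∈ augFil (M - v j₀) := by
      intro j hj k
      have : ∑ a ∈ t, A j a * B a k - ∑ a ∈ t.erase a₀, A j a * (B a k - γ a * (u * B a₀ k)) =
          A j a₀ * ((1 - γ a₀ * u) * B a₀ k) + (∑ a ∈ t, A j a * γ a) * (u * B a₀ k) := by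
        rw [Finset.sum_mul, ← Finset.add_sum_erase t _ ha₀, ← Finset.add_sum_erase t _ ha₀]
        simp only [mul_sub, Finset.sum_sub_distrib, mul_assoc, sub_mul, one_mul]
        abel
      rw [this]
      exact add_mem (Ideal.mul_mem_left _ _ (mul_mem_augFil_right hu _))
        (mul_mem_augFil_right (hγ j hj) _)
    have hcard := ih (t := t.erase a₀) (B := fun a k => B a k - γ a * (u * B a₀ k))
      (M := M - v j₀) (by omega)
      (fun j hj k hk hkj => by
        have h1 := augFil_antitone (Nat.sub_le M (v j₀))
          (hlow j (Finset.mem_insert_of_mem hj) k (Finset.mem_insert_of_mem hk) hkj)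
        simpa using sub_mem h1 (key j hj k))
      (fun j hj hmem => by
        have hle : v j ≤ M - v j₀ := by
          have := Finset.single_le_sum (f := v) (fun _ _ => Nat.zero_le _) hj
          omega
        refine hdiag j (Finset.mem_insert_of_mem hj) ?_
        simpa using add_mem (augFil_antitone hle (key j hj j)) hmem)
    rw [Finset.card_erase_of_mem ha₀] at hcard
    have := Finset.card_pos.2 ⟨a₀, ha₀⟩
    omega

/-- A triangular matrix with nonzero diagonal over the group ring of a free group does not
factor through a matrix of smaller size. -/
theorem card_le_of_triangular {ι κ : Type*} [LinearOrder ι]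
    {A : ι → κ → FreeGroupRing X} {s : Finset ι} {t : Finset κ} {B : κ → ι → FreeGroupRing X}
    (hlow : ∀ j ∈ s, ∀ k ∈ s, k < j → ∑ a ∈ t, A j a * B a k = 0)
    (hdiag : ∀ j ∈ s, ∑ a ∈ t, A j a * B a j ≠ 0) : s.card ≤ t.card := by
  have : ∀ j, ∃ v : ℕ, j ∈ s → ∑ a ∈ t, A j a * B a j ∉ augFil v := by
    intro j
    by_cases hj : j ∈ s
    · by_contra! h
      exact hdiag j hj (eq_zero_of_forall_mem_augFil fun n => (h n).2)
    · exact ⟨0, fun h => absurd h hj⟩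
  choose v hv using this
  exact card_le_of_triangular_mod_augFil (le_refl (∑ i ∈ s, v i))
    (fun j hj k hk hkj => by rw [hlow j hj k hk hkj]; exact zero_mem _) hv

/-- The endomorphism of the group ring induced by an endomorphism of the free group. -/
noncomputable def mapRing (θ : FreeGroup X →* FreeGroup X) : FreeGroupRing X →+* FreeGroupRing X :=
  MonoidAlgebra.mapDomainRingHom ℚ θ

theorem mapRing_of (θ : FreeGroup X →* FreeGroup X) (g : FreeGroup X) :
    mapRing θ (of g) = of (θ g) := by
  simp [mapRing, of]

theorem mapRing_injective {θ : FreeGroup X →* FreeGroup X} (hθ : Function.Injective θ) :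
    Function.Injective (mapRing θ) :=
  MonoidAlgebra.mapDomain_injective hθ

/-- The left ideal generated by the elements `g - 1` for `g ∈ S`. -/
noncomputable def subgroupIdeal (S : Set (FreeGroup X)) : Ideal (FreeGroupRing X) :=
  Submodule.span _ ((fun g => of g - 1) '' S)

theorem of_sub_one_mem_subgroupIdeal {S : Set (FreeGroup X)} {g : FreeGroup X} (hg : g ∈ S) :
    of g - 1 ∈ subgroupIdeal S := Submodule.subset_span ⟨g, hg, rfl⟩

theorem subgroupIdeal_mono {S T : Set (FreeGroup X)} (h : S ⊆ T) :
    subgroupIdeal S ≤ subgroupIdeal T := Submodule.span_mono (Set.image_mono h)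

theorem subgroupIdeal_closure (S : Set (FreeGroup X)) :
    subgroupIdeal (Subgroup.closure S : Set (FreeGroup X)) = subgroupIdeal S := by
  refine le_antisymm (Submodule.span_le.2 ?_) (subgroupIdeal_mono Subgroup.subset_closure)
  rintro _ ⟨g, hg, rfl⟩
  induction hg using Subgroup.closure_induction with
  | mem x hx => exact of_sub_one_mem_subgroupIdeal hx
  | one => simp
  | mul x y _ _ hx hy =>
    have : of (x * y) - 1 = of x * (of y - 1) + (of x - 1) := by rw [map_mul]; noncomm_ring
    simp only [this]
    exact add_mem (Ideal.mul_mem_left _ _ hy) hx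
  | inv x _ hx =>
    have : of x⁻¹ - 1 = - of x⁻¹ * (of x - 1) := by
      rw [mul_sub, neg_mul, ← map_mul, inv_mul_cancel, map_one]; noncomm_ring
    simp only [this]
    exact Ideal.mul_mem_left _ _ hx

section Orbit

variable {r : ℕ} (θ : FreeGroup X →* FreeGroup X) (e : ℕ → Fin r → FreeGroup X)

/-- The relation map sending the basis vector at `(l, k)` to `e l k - 1`. -/
noncomputable def orbitMap : (ℕ × Fin r →₀ FreeGroupRing X) →ₗ[FreeGroupRing X] FreeGroupRing X :=
  Finsupp.linearCombination _ fun x => of (e x.1 x.2) - 1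

/-- The shift of orbit coordinates, twisted by `θ`. -/
noncomputable def orbitShift : (ℕ × Fin r →₀ FreeGroupRing X) →+ (ℕ × Fin r →₀ FreeGroupRing X) :=
  Finsupp.liftAddHom fun x =>
    (Finsupp.singleAddHom (x.1 + 1, x.2)).comp (mapRing θ).toAddMonoidHom

/-- The `i`-fold `θ`-twisted Fox derivative of the basis vector at `(l, k)`. -/
noncomputable def twistedFoxBasis : ℕ → ℕ → Fin r → X →₀ FreeGroupRing X
  | 0, l, k => foxGroup (e l k)
  | _ + 1, 0, _ => 0
  | i + 1, l + 1, k => (twistedFoxBasis i l k).mapRange (mapRing θ) (map_zero _)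

/-- The `i`-fold `θ`-twisted Fox derivative of orbit coordinates. -/
noncomputable def twistedFox (i : ℕ) :
    (ℕ × Fin r →₀ FreeGroupRing X) →ₗ[FreeGroupRing X] X →₀ FreeGroupRing X :=
  Finsupp.linearCombination _ fun x => twistedFoxBasis θ e i x.1 x.2

variable {θ e}

theorem orbitShift_single (x : ℕ × Fin r) (f : FreeGroupRing X) :
    orbitShift θ (Finsupp.single x f) = Finsupp.single (x.1 + 1, x.2) (mapRing θ f) := by
  simp [orbitShift]

theorem orbitMap_orbitShift (he : ∀ l k, θ (e l k) = e (l + 1) k)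
    (p : ℕ × Fin r →₀ FreeGroupRing X) :
    orbitMap e (orbitShift θ p) = mapRing θ (orbitMap e p) := by
  induction p using Finsupp.induction_linear with
  | zero => simp
  | add p q hp hq => simp only [map_add, hp, hq]
  | single x f =>
    simp [orbitShift_single, orbitMap, mapRing_of, he]

theorem twistedFox_succ_orbitShift (i : ℕ) (p : ℕ × Fin r →₀ FreeGroupRing X) (c : X) :
    twistedFox θ e (i + 1) (orbitShift θ p) c = mapRing θ (twistedFox θ e i p c) := by
  induction p using Finsupp.induction_linear with
  | zero => simp
  | add p q hp hq => simp only [map_add, Finsupp.add_apply, hp, hq]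
  | single x f =>
    simp [orbitShift_single, twistedFox, twistedFoxBasis]

theorem twistedFox_zero (p : ℕ × Fin r →₀ FreeGroupRing X) :
    twistedFox θ e 0 p = fox (orbitMap e p) := by
  induction p using Finsupp.induction_linear with
  | zero => simp
  | add p q hp hq => simp only [map_add, hp, hq]
  | single x f =>
    simp only [twistedFox, orbitMap, Finsupp.linearCombination_single, smul_eq_mul, fox_mul,
      map_sub, aug_of, map_one, sub_self, zero_smul, zero_add, fox_of, fox_one, sub_zero,
      twistedFoxBasis]

theorem twistedFox_add_iterate (i l : ℕ) (p : ℕ × Fin r →₀ FreeGroupRing X) (c : X) :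
    twistedFox θ e (l + i) ((orbitShift θ)^[l] p) c = (mapRing θ)^[l] (twistedFox θ e i p c) := by
  induction l with
  | zero => simp
  | succ l ih =>
    rw [add_right_comm, Function.iterate_succ_apply', twistedFox_succ_orbitShift, ih,
      Function.iterate_succ_apply']

theorem twistedFox_iterate_eq_zero (he : ∀ l k, θ (e l k) = e (l + 1) k) {i l : ℕ} (h : i ≤ l)
    {p : ℕ × Fin r →₀ FreeGroupRing X} (hp : orbitMap e p = 0) (c : X) :
    twistedFox θ e i ((orbitShift θ)^[l] p) c = 0 := by
  obtain ⟨m, rfl⟩ := Nat.exists_eq_add_of_le h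
  have h0 : orbitMap e ((orbitShift θ)^[m] p) = 0 := by
    clear h
    induction m with
    | zero => exact hp
    | succ m ih => rw [Function.iterate_succ_apply', orbitMap_orbitShift he, ih, map_zero]
  rw [Function.iterate_add_apply]
  have := twistedFox_add_iterate (θ := θ) (e := e) 0 i ((orbitShift θ)^[m] p) c
  rw [add_zero, twistedFox_zero, h0, map_zero, Finsupp.zero_apply] at this
  rw [this]
  exact iterate_map_zero _ _

theorem orbitShift_iterate_apply_eq_zero {p : ℕ × Fin r →₀ FreeGroupRing X} {c : ℕ}
    (hp : ∀ x, c ≤ x.1 → p x = 0) (l : ℕ) (x : ℕ × Fin r) (hx : c + l ≤ x.1) :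
    (orbitShift θ)^[l] p x = 0 := by
  classical
  induction l generalizing x with
  | zero => exact hp x hx
  | succ l ih =>
    rw [Function.iterate_succ_apply']
    generalize (orbitShift θ)^[l] p = q at ih
    simp only [orbitShift, Finsupp.liftAddHom_apply, Finsupp.sum, Finsupp.finsetSum_apply]
    refine Finset.sum_eq_zero fun y _ => ?_
    simp only [AddMonoidHom.comp_apply, Finsupp.singleAddHom_apply, Finsupp.single_apply]
    split_ifs with h
    · rw [ih y (by rw [← h] at hx; simp at hx; omega), map_zero]
    · rfl

theorem twistedFox_apply_eq_sum (i : ℕ) {p : ℕ × Fin r →₀ FreeGroupRing X} {c : ℕ}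
    (hp : ∀ x, c ≤ x.1 → p x = 0) (b : X) :
    twistedFox θ e i p b =
      ∑ x ∈ Finset.range c ×ˢ Finset.univ, p x * twistedFoxBasis θ e i x.1 x.2 b := by
  rw [twistedFox, Finsupp.linearCombination_apply, Finsupp.sum_of_support_subset
    (s := Finset.range c ×ˢ Finset.univ), Finsupp.finsetSum_apply]
  · rfl
  · intro x hx
    by_contra hcon
    exact Finsupp.mem_support_iff.1 hx (hp x (by simpa using hcon))
  · simp

theorem exists_bound (p : ℕ × Fin r →₀ FreeGroupRing X) : ∃ c, ∀ x, c ≤ x.1 → p x = 0 := by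
  refine ⟨p.support.sup Prod.fst + 1, fun x hx => ?_⟩
  by_contra h
  have := Finset.le_sup (f := Prod.fst) (Finsupp.mem_support_iff.2 h)
  omega

theorem finite_setOf_twistedFox_ne_zero (hθ : Function.Injective θ)
    (he : ∀ l k, θ (e l k) = e (l + 1) k) :
    {b : X | ∃ p, orbitMap e p = 0 ∧ twistedFox θ e 1 p b ≠ 0}.Finite := by
  classical
  by_contra hinf
  obtain ⟨f, hf, hlt⟩ := exists_seq_of_forall_finset_exists
    (α := (ℕ × Fin r →₀ FreeGroupRing X) × X)
    (fun y => orbitMap e y.1 = 0 ∧ twistedFox θ e 1 y.1 y.2 ≠ 0)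
    (fun x y => twistedFox θ e 1 x.1 y.2 = 0) (fun s _ => by
      obtain ⟨b, ⟨p, hp, hb⟩, hbs⟩ := Set.Infinite.exists_notMem_finset hinf
        (s.biUnion fun x => (twistedFox θ e 1 x.1).support)
      refine ⟨(p, b), ⟨hp, hb⟩, fun x hx => ?_⟩
      by_contra hne
      exact hbs (Finset.mem_biUnion.2 ⟨x, hx, Finsupp.mem_support_iff.2 hne⟩))
  choose c hc using fun n => exists_bound (f n).1
  obtain ⟨C, hC⟩ : ∃ C, ∀ n ∈ Finset.range (r + 1), c n ≤ C :=
    ⟨_, fun n hn => Finset.le_sup (f := c) hn⟩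
  let m := C * r + 1
  let s : Finset (ℕ ×ₗ ℕᵒᵈ) := (Finset.range m ×ˢ Finset.range (r + 1)).map
    ((Equiv.prodCongr (Equiv.refl ℕ) OrderDual.toDual).trans toLex).toEmbedding
  let row (l j : ℕ) := (orbitShift θ)^[l] (f j).1
  have hrow : ∀ l < m, ∀ j < r + 1, ∀ x : ℕ × Fin r, C + m ≤ x.1 → row l j x = 0 := by
    intro l hl j hj x hx
    refine orbitShift_iterate_apply_eq_zero (hc j) l x ?_
    have := hC j (Finset.mem_range.2 hj)
    omega
  have hs : ∀ x ∈ s, ∃ l < m, ∃ j < r + 1, x = toLex (l, OrderDual.toDual j) := by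
    intro x hx
    obtain ⟨⟨l, j⟩, hlj, rfl⟩ := Finset.mem_map.1 hx
    rw [Finset.mem_product, Finset.mem_range, Finset.mem_range] at hlj
    exact ⟨l, hlj.1, j, hlj.2, rfl⟩
  have hcard := card_le_of_triangular (s := s)
    (t := Finset.range (C + m) ×ˢ (Finset.univ : Finset (Fin r)))
    (A := fun y x => row (ofLex y).1 (OrderDual.ofDual (ofLex y).2) x)
    (B := fun x y => twistedFoxBasis θ e ((ofLex y).1 + 1) x.1 x.2
      (f (OrderDual.ofDual (ofLex y).2)).2)
    (fun x hx y hy hyx => by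
      obtain ⟨l, hl, j, hj, rfl⟩ := hs x hx
      obtain ⟨i, hi, k, hk, rfl⟩ := hs y hy
      refine (twistedFox_apply_eq_sum (i + 1) (hrow l hl j hj) (f k).2).symm.trans ?_
      rcases Prod.Lex.toLex_lt_toLex.1 hyx with h | ⟨h, h'⟩
      · exact twistedFox_iterate_eq_zero he h (hf j).1 _
      · obtain rfl : i = l := h
        rw [twistedFox_add_iterate, hlt j k (OrderDual.toDual_lt_toDual.1 h')]
        exact iterate_map_zero _ _)
    (fun x hx => by
      obtain ⟨l, hl, j, hj, rfl⟩ := hs x hx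
      refine ne_of_eq_of_ne (twistedFox_apply_eq_sum (l + 1) (hrow l hl j hj) (f j).2).symm ?_
      rw [twistedFox_add_iterate]
      intro h
      rw [← iterate_map_zero (mapRing θ) l] at h
      exact (hf j).2 ((mapRing_injective hθ).iterate l h))
  simp only [s, Finset.card_map, Finset.card_product, Finset.card_range, Finset.card_univ,
    Fintype.card_fin, m] at hcard
  nlinarith

theorem linearCombination_twistedFox_one (he : ∀ l k, θ (e l k) = e (l + 1) k)
    (p : ℕ × Fin r →₀ FreeGroupRing X) :
    Finsupp.linearCombination (FreeGroupRing X) (fun c => of (θ (FreeGroup.of c)) - 1)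
      (twistedFox θ e 1 p) = orbitMap e (p.filter fun x => x.1 ≠ 0) := by
  induction p using Finsupp.induction_linear with
  | zero => rw [Finsupp.filter_zero, map_zero, map_zero, map_zero]
  | add p q hp hq => simp only [map_add, Finsupp.filter_add, hp, hq]
  | single x f =>
    obtain ⟨l, k⟩ := x
    cases l with
    | zero => simp [twistedFox, twistedFoxBasis]
    | succ l =>
      rw [Finsupp.filter_single_of_pos (p := fun x : ℕ × Fin r => x.1 ≠ 0)
        (Nat.succ_ne_zero l)]
      simp only [twistedFox, orbitMap, Finsupp.linearCombination_single, map_smul, twistedFoxBasis]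
      have h1 := congrArg (mapRing θ) (sub_aug_eq_linearCombination (of (e l k)))
      rw [aug_of, map_one, map_sub, map_one, mapRing_of, he, fox_of,
        Finsupp.linearCombination_apply, map_finsuppSum] at h1
      rw [h1, Finsupp.linearCombination_apply, Finsupp.sum_mapRange_index (by simp)]
      simp [mapRing_of]

/-- The subgroup generated by the first `n + 1` levels of the orbit. -/
def orbitSubgroup {G : Type*} [Group G] {r : ℕ} (e : ℕ → Fin r → G) (n : ℕ) : Subgroup G :=
  Subgroup.closure {g | ∃ l ≤ n, ∃ k, e l k = g}

theorem orbitSubgroup_mono {G : Type*} [Group G] {r : ℕ} (e : ℕ → Fin r → G) :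
    Monotone (orbitSubgroup e) := fun _ _ h =>
  Subgroup.closure_mono fun _ ⟨l, hl, k, hk⟩ => ⟨l, hl.trans h, k, hk⟩

theorem mem_orbitSubgroup {G : Type*} [Group G] {r : ℕ} (e : ℕ → Fin r → G) {n l : ℕ} (h : l ≤ n)
    (k : Fin r) : e l k ∈ orbitSubgroup e n := Subgroup.subset_closure ⟨l, h, k, rfl⟩

theorem exists_mem_orbitSubgroup {G : Type*} [Group G] {r : ℕ} (e : ℕ → Fin r → G)
    (h : Subgroup.closure {g | ∃ l k, e l k = g} = ⊤) (g : G) : ∃ n, g ∈ orbitSubgroup e n := by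
  have hg : g ∈ Subgroup.closure {g | ∃ l k, e l k = g} := h ▸ Subgroup.mem_top g
  induction hg using Subgroup.closure_induction with
  | mem x hx =>
    obtain ⟨l, k, rfl⟩ := hx
    exact ⟨l, mem_orbitSubgroup e le_rfl k⟩
  | one => exact ⟨0, one_mem _⟩
  | mul x y _ _ hx hy =>
    obtain ⟨n, hn⟩ := hx
    obtain ⟨m, hm⟩ := hy
    exact ⟨max n m, mul_mem (orbitSubgroup_mono e (le_max_left _ _) hn)
      (orbitSubgroup_mono e (le_max_right _ _) hm)⟩
  | inv x _ hx => exact hx.imp fun n hn => inv_mem hn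

theorem exists_forall_mem_subgroupIdeal (hθ : Function.Injective θ)
    (he : ∀ l k, θ (e l k) = e (l + 1) k) (hgen : Subgroup.closure {g | ∃ l k, e l k = g} = ⊤) :
    ∃ j, ∀ n ≥ j, ∀ u ∈ subgroupIdeal (orbitSubgroup e (n + 1) : Set (FreeGroup X)),
      u ∈ subgroupIdeal (θ.range : Set (FreeGroup X)) →
      u ∈ subgroupIdeal ((orbitSubgroup e n).map θ : Set (FreeGroup X)) := by
  have hfin := finite_setOf_twistedFox_ne_zero hθ he
  choose d hd using fun b : X => exists_mem_orbitSubgroup e hgen (FreeGroup.of b)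
  refine ⟨hfin.toFinset.sup d, fun n hn u hu hu' => ?_⟩
  rw [orbitSubgroup, subgroupIdeal_closure] at hu
  have himg : θ.range = Subgroup.closure {g | ∃ l k, e (l + 1) k = g} := by
    rw [MonoidHom.range_eq_map, ← hgen, MonoidHom.map_closure]
    congr 1
    ext g
    constructor
    · rintro ⟨_, ⟨l, k, rfl⟩, rfl⟩
      exact ⟨l, k, (he l k).symm⟩
    · rintro ⟨l, k, rfl⟩
      exact ⟨_, ⟨l, k, rfl⟩, he l k⟩
  rw [himg, subgroupIdeal_closure] at hu'
  have hu1 : u ∈ Submodule.span (FreeGroupRing X)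
      ((fun x : ℕ × Fin r => of (e x.1 x.2) - 1) '' {x | x.1 ≤ n + 1}) := by
    refine Submodule.span_mono ?_ hu
    rintro _ ⟨_, ⟨l, hl, k, rfl⟩, rfl⟩
    exact ⟨(l, k), hl, rfl⟩
  have hu2 : u ∈ Submodule.span (FreeGroupRing X)
      ((fun x : ℕ × Fin r => of (e x.1 x.2) - 1) '' {x | x.1 ≠ 0}) := by
    refine Submodule.span_mono ?_ hu'
    rintro _ ⟨_, ⟨l, k, rfl⟩, rfl⟩
    exact ⟨(l + 1, k), Nat.succ_ne_zero l, rfl⟩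
  obtain ⟨p, hp, rfl⟩ := (Finsupp.mem_span_image_iff_linearCombination _).1 hu1
  obtain ⟨q, hq, hpq⟩ := (Finsupp.mem_span_image_iff_linearCombination _).1 hu2
  change orbitMap e q = orbitMap e p at hpq
  change orbitMap e p ∈ _
  have hq' : q.filter (fun x => x.1 ≠ 0) = q :=
    (Finsupp.filter_eq_self_iff _ _).2 fun x hx => hq (Finsupp.mem_support_iff.2 hx)
  have key : orbitMap e p = orbitMap e (p.filter fun x => x.1 ≠ 0) -
      orbitMap e ((p - q).filter fun x => x.1 ≠ 0) := by
    rw [Finsupp.filter_sub, map_sub, hq', hpq, sub_sub_cancel]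
  rw [key]
  refine sub_mem ?_ ?_
  · rw [orbitMap, Finsupp.linearCombination_apply]
    refine Submodule.finsuppSum_mem _ _ _ _ fun x hx => Ideal.mul_mem_left _ _ ?_
    obtain ⟨h0, hne⟩ : x.1 ≠ 0 ∧ p x ≠ 0 := by
      by_contra h
      apply hx
      rw [Finsupp.filter_apply]
      split_ifs with h'
      · by_contra h2; exact h ⟨h', h2⟩
      · rfl
    have hle : x.1 ≤ n + 1 := hp (Finsupp.mem_support_iff.2 hne)
    obtain ⟨l, hl⟩ := Nat.exists_eq_succ_of_ne_zero h0
    refine of_sub_one_mem_subgroupIdeal ⟨e l x.2, mem_orbitSubgroup e (by omega) _, ?_⟩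
    rw [he, hl]
  · rw [← linearCombination_twistedFox_one he, Finsupp.linearCombination_apply]
    refine Submodule.finsuppSum_mem _ _ _ _ fun b hb => Ideal.mul_mem_left _ _ ?_
    refine of_sub_one_mem_subgroupIdeal ⟨FreeGroup.of b, orbitSubgroup_mono e ?_ (hd b), rfl⟩
    refine le_trans (Finset.le_sup (f := d) (hfin.mem_toFinset.2 ⟨p - q, ?_, hb⟩)) hn
    rw [map_sub, hpq, sub_self]

end Orbit

/-- The linear functional counting the group elements that lie in `C`. -/
noncomputable def countIn (C : Subgroup (FreeGroup X)) : FreeGroupRing X →ₗ[ℚ] ℚ :=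
  (Finsupp.linearCombination ℚ ((C : Set (FreeGroup X)).indicator 1)).comp
    (MonoidAlgebra.coeffLinearEquiv ℚ).toLinearMap

theorem countIn_of (C : Subgroup (FreeGroup X)) (g : FreeGroup X) :
    countIn C (of g) = (C : Set (FreeGroup X)).indicator 1 g := by
  simp [countIn, of]

theorem countIn_of_of_mem {C : Subgroup (FreeGroup X)} {g : FreeGroup X} (hg : g ∈ C) :
    countIn C (of g) = 1 := by
  rw [countIn_of, Set.indicator_of_mem (show g ∈ (C : Set _) from hg)]; rfl

theorem countIn_of_of_notMem {C : Subgroup (FreeGroup X)} {g : FreeGroup X} (hg : g ∉ C) :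
    countIn C (of g) = 0 := by
  rw [countIn_of, Set.indicator_of_notMem (show g ∉ (C : Set _) from hg)]

theorem countIn_mul_eq_zero {C : Subgroup (FreeGroup X)} {u : FreeGroupRing X}
    (hu : u ∈ subgroupIdeal (C : Set (FreeGroup X))) (r : FreeGroupRing X) :
    countIn C (r * u) = 0 := by
  induction hu using Submodule.span_induction generalizing r with
  | mem x hx =>
    obtain ⟨c, hc, rfl⟩ := hx
    induction r using ring_induction with
    | of g =>
      simp only [mul_sub, mul_one, ← map_mul, map_sub]
      by_cases h : g ∈ C
      · rw [countIn_of_of_mem h, countIn_of_of_mem (mul_mem h hc), sub_self]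
      · rw [countIn_of_of_notMem h, countIn_of_of_notMem fun h' => h (by
          simpa using mul_mem h' (inv_mem hc)), sub_self]
    | add a b ha hb => rw [add_mul, map_add, ha, hb, add_zero]
    | smul q a ha => rw [smul_mul_assoc, map_smul, ha, smul_zero]
  | zero => rw [mul_zero, map_zero]
  | add x y _ _ hx hy => rw [mul_add, map_add, hx, hy, add_zero]
  | smul s x _ hx => rw [smul_eq_mul, ← mul_assoc, hx]

theorem countIn_eq_zero {C : Subgroup (FreeGroup X)} {u : FreeGroupRing X}
    (hu : u ∈ subgroupIdeal (C : Set (FreeGroup X))) : countIn C u = 0 := by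
  simpa using countIn_mul_eq_zero hu 1

section Amalgam

variable {A B C : Subgroup (FreeGroup X)} {Q : Type*} [Group Q] {f : A →* Q} {g : B →* Q}

/-- The product of a word in two subgroups. -/
def wordProd (L : List (A ⊕ B)) : FreeGroup X := (L.map (Sum.elim (↑) (↑))).prod

/-- The image of a word in two subgroups under a pair of homomorphisms. -/
def wordMap (f : A →* Q) (g : B →* Q) (L : List (A ⊕ B)) : Q := (L.map (Sum.elim f g)).prod

theorem wordProd_nil : wordProd ([] : List (A ⊕ B)) = 1 := rfl

theorem wordProd_cons_inl (a : A) (L : List (A ⊕ B)) :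
    wordProd (Sum.inl a :: L) = a * wordProd L := by simp [wordProd]

theorem wordProd_cons_inr (b : B) (L : List (A ⊕ B)) :
    wordProd (Sum.inr b :: L) = b * wordProd L := by simp [wordProd]

theorem wordProd_append (L L' : List (A ⊕ B)) :
    wordProd (L ++ L') = wordProd L * wordProd L' := by simp [wordProd]

theorem wordMap_nil : wordMap f g [] = 1 := rfl

theorem wordMap_cons_inl (a : A) (L : List (A ⊕ B)) :
    wordMap f g (Sum.inl a :: L) = f a * wordMap f g L := by simp [wordMap]

theorem wordMap_cons_inr (b : B) (L : List (A ⊕ B)) :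
    wordMap f g (Sum.inr b :: L) = g b * wordMap f g L := by simp [wordMap]

theorem wordMap_append (L L' : List (A ⊕ B)) :
    wordMap f g (L ++ L') = wordMap f g L * wordMap f g L' := by simp [wordMap]

/-- The weight of a word: letters of the first subgroup count twice. -/
def wordWeight (L : List (A ⊕ B)) : ℕ := (L.map (Sum.elim (fun _ => 2) (fun _ => 1))).sum

/-- The contribution of the letters from the first subgroup to the telescoping sum along a word
starting at `x`. -/
noncomputable def leftSum : FreeGroup X → List (A ⊕ B) → FreeGroupRing X
  | _, [] => 0
  | x, Sum.inl a :: L => of x * (of (a : FreeGroup X) - 1) + leftSum (x * a) L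
  | x, Sum.inr b :: L => leftSum (x * b) L

theorem leftSum_mem_left (x : FreeGroup X) (L : List (A ⊕ B)) :
    leftSum x L ∈ subgroupIdeal (A : Set (FreeGroup X)) := by
  induction L generalizing x with
  | nil => exact zero_mem _
  | cons l L ih =>
    cases l with
    | inl a => exact add_mem (Ideal.mul_mem_left _ _ (of_sub_one_mem_subgroupIdeal a.2)) (ih _)
    | inr b => exact ih _

theorem leftSum_sub_mem_right (x : FreeGroup X) (L : List (A ⊕ B)) :
    (of (x * wordProd L) - of x) - leftSum x L ∈ subgroupIdeal (B : Set (FreeGroup X)) := by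
  induction L generalizing x with
  | nil => simp [wordProd, leftSum]
  | cons l L ih =>
    cases l with
    | inl a =>
      convert ih (x * a) using 1
      rw [wordProd_cons_inl, mul_assoc, leftSum, mul_sub, ← map_mul]
      noncomm_ring
    | inr b =>
      convert add_mem (ih (x * b)) (Ideal.mul_mem_left _ (of x)
        (of_sub_one_mem_subgroupIdeal b.2)) using 1
      rw [wordProd_cons_inr, mul_assoc, leftSum, mul_sub, ← map_mul]
      noncomm_ring

theorem countIn_leftSum_nonpos (x : FreeGroup X) (L : List (A ⊕ B))
    (h : ∀ (P : List (A ⊕ B)) (a : A) (S : List (A ⊕ B)),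
      L = P ++ Sum.inl a :: S → x * wordProd P * (a : FreeGroup X) ∉ C) :
    countIn C (leftSum x L) ≤ 0 := by
  induction L generalizing x with
  | nil => simp [leftSum]
  | cons l L ih =>
    cases l with
    | inl a =>
      have h1 : x * a ∉ C := by simpa [wordProd] using h [] a L rfl
      have h2 := ih (x * a) fun P a' S hL => by
        simpa [wordProd_cons_inl, mul_assoc] using h (Sum.inl a :: P) a' S (by rw [hL]; rfl)
      have h3 : 0 ≤ countIn C (of x) := by
        by_cases hx : x ∈ C
        · rw [countIn_of_of_mem hx]; norm_num
        · rw [countIn_of_of_notMem hx]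
      rw [leftSum, mul_sub, ← map_mul, mul_one, map_add, map_sub, countIn_of_of_notMem h1]
      linarith
    | inr b =>
      exact ih (x * b) fun P a' S hL => by
        simpa [wordProd_cons_inr, mul_assoc] using h (Sum.inr b :: P) a' S (by rw [hL]; rfl)

theorem exists_prefix_mem (hC : ∀ u, u ∈ subgroupIdeal (A : Set (FreeGroup X)) →
      u ∈ subgroupIdeal (B : Set (FreeGroup X)) → u ∈ subgroupIdeal (C : Set (FreeGroup X)))
    {a : A} {L : List (A ⊕ B)} (h1 : wordProd (Sum.inl a :: L) = 1) :
    ∃ (P : List (A ⊕ B)) (a' : A) (S : List (A ⊕ B)),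
      Sum.inl a :: L = P ++ Sum.inl a' :: S ∧ wordProd P * (a' : FreeGroup X) ∈ C := by
  by_contra! hcon
  have hmem := hC _ (leftSum_mem_left 1 (Sum.inl a :: L)) (by
    have := leftSum_sub_mem_right 1 (Sum.inl a :: L)
    rw [h1, mul_one, sub_self, zero_sub] at this
    exact neg_mem_iff.1 this)
  have h0 := countIn_eq_zero hmem
  have ha : (a : FreeGroup X) ∉ C := by simpa [wordProd] using hcon [] a L rfl
  have h2 := countIn_leftSum_nonpos (C := C) (1 * (a : FreeGroup X)) L fun P a' S hL => by
    simpa [wordProd_cons_inl, mul_assoc] using hcon (Sum.inl a :: P) a' S (by rw [hL]; rfl)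
  rw [leftSum, map_one, one_mul, map_add, map_sub, countIn_of_of_notMem ha,
    ← map_one of, countIn_of_of_mem (one_mem C)] at h0
  linarith

theorem wordMap_eq_one (hCA : C ≤ A) (hCB : C ≤ B)
    (hC : ∀ u, u ∈ subgroupIdeal (A : Set (FreeGroup X)) →
      u ∈ subgroupIdeal (B : Set (FreeGroup X)) → u ∈ subgroupIdeal (C : Set (FreeGroup X)))
    (hfg : ∀ c (hc : c ∈ C), f ⟨c, hCA hc⟩ = g ⟨c, hCB hc⟩)
    (L : List (A ⊕ B)) (hL : wordProd L = 1) : wordMap f g L = 1 := by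
  induction hn : wordWeight L using Nat.strong_induction_on generalizing L with
  | _ n ih =>
  subst hn
  by_cases hinl : ∃ a, Sum.inl a ∈ L
  · obtain ⟨a, ha⟩ := hinl
    obtain ⟨L₁, L₂, rfl⟩ := List.append_of_mem ha
    rw [wordProd_append, mul_eq_one_iff_inv_eq, eq_comm, ← mul_eq_one_iff_eq_inv,
      ← wordProd_append, List.cons_append] at hL
    rw [wordMap_append, mul_eq_one_iff_inv_eq, eq_comm, ← mul_eq_one_iff_eq_inv,
      ← wordMap_append, List.cons_append]
    have hw : wordWeight (L₁ ++ Sum.inl a :: L₂) = wordWeight (Sum.inl a :: (L₂ ++ L₁)) := by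
      simp [wordWeight]; ring
    rw [hw] at ih
    obtain ⟨P, a', S, hPS, hmem⟩ := exists_prefix_mem hC hL
    rw [hPS] at ih hL ⊢
    have hS : wordMap f g (Sum.inr ⟨_, hCB hmem⟩ :: S) = 1 := by
      refine ih _ ?_ _ ?_ rfl
      · simp [wordWeight]; omega
      · rw [wordProd_cons_inr, ← hL, wordProd_append, wordProd_cons_inl, mul_assoc]
    rw [wordMap_cons_inr, ← hfg _ hmem] at hS
    rw [wordMap_append, wordMap_cons_inl]
    cases P with
    | nil =>
      simp only [wordProd_nil, one_mul] at hS
      rw [wordMap_nil, one_mul, hS]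
    | cons p V =>
      obtain rfl : Sum.inl a = p := (List.cons.inj hPS).1
      set c : A := ⟨_, hCA hmem⟩ with hc
      have hV : wordMap f g (V ++ [Sum.inl (a' * c⁻¹ * a)]) = 1 := by
        refine ih _ ?_ _ ?_ rfl
        · simp [wordWeight]; omega
        · rw [wordProd_append, wordProd_cons_inl, wordProd_nil, mul_one, hc]
          simp only [Subgroup.coe_mul, Subgroup.coe_inv, wordProd_cons_inl]
          group
      rw [wordMap_append, wordMap_cons_inl, wordMap_nil, mul_one, map_mul, map_mul, map_inv] at hV
      rw [wordMap_cons_inl, eq_inv_of_mul_eq_one_left hV, ← hS]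
      group
  · push Not at hinl
    have key : ∀ M : List (A ⊕ B), (∀ a, Sum.inl a ∉ M) →
        ∃ b : B, wordProd M = b ∧ wordMap f g M = g b := by
      intro M hM
      induction M with
      | nil => exact ⟨1, by simp [wordProd], by simp [wordMap]⟩
      | cons l M ihM =>
        obtain ⟨b, hb, hb'⟩ := ihM fun a ha => hM a (List.mem_cons_of_mem _ ha)
        cases l with
        | inl a => exact absurd List.mem_cons_self (hM a)
        | inr b₀ => exact ⟨b₀ * b, by rw [wordProd_cons_inr, hb]; rfl, by
            rw [wordMap_cons_inr, hb', map_mul]⟩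
    obtain ⟨b, hb, hb'⟩ := key L hinl
    rw [hb', show b = 1 from Subtype.ext (hb ▸ hL), map_one]

/-- Homomorphisms on two subgroups of a free group that agree on `C` extend to the join, as soon as
the relation ideals of the two subgroups intersect in the relation ideal of `C`. -/
theorem exists_hom_sup (hCA : C ≤ A) (hCB : C ≤ B)
    (hC : ∀ u, u ∈ subgroupIdeal (A : Set (FreeGroup X)) →
      u ∈ subgroupIdeal (B : Set (FreeGroup X)) → u ∈ subgroupIdeal (C : Set (FreeGroup X)))
    (hfg : ∀ c (hc : c ∈ C), f ⟨c, hCA hc⟩ = g ⟨c, hCB hc⟩) :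
    ∃ φ : ↥(A ⊔ B) →* Q, (∀ a : A, φ ⟨a, le_sup_left (a := A) (b := B) a.2⟩ = f a) ∧
      ∀ b : B, φ ⟨b, le_sup_right (a := A) (b := B) b.2⟩ = g b := by
  let p : Monoid.Coprod A B →* ↥(A ⊔ B) :=
    Monoid.Coprod.lift (Subgroup.inclusion le_sup_left) (Subgroup.inclusion le_sup_right)
  let q : Monoid.Coprod A B →* Q := Monoid.Coprod.lift f g
  have hp : Function.Surjective p := by
    rw [← MonoidHom.range_eq_top, Monoid.Coprod.range_lift]
    refine Subgroup.map_injective (A ⊔ B).subtype_injective ?_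
    rw [Subgroup.map_sup, ← MonoidHom.range_comp, ← MonoidHom.range_comp, ← MonoidHom.range_eq_map,
      Subgroup.range_subtype]
    exact congrArg₂ _ A.range_subtype B.range_subtype
  have hpL : ∀ L : List (A ⊕ B),
      (p (Monoid.Coprod.mk (FreeMonoid.ofList L)) : FreeGroup X) = wordProd L := by
    intro L
    induction L with
    | nil => rfl
    | cons l L ih =>
      rw [FreeMonoid.ofList_cons, map_mul, map_mul, Subgroup.coe_mul, ih]
      cases l with
      | inl a => rw [wordProd_cons_inl]; rfl
      | inr b => rw [wordProd_cons_inr]; rfl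
  have hqL : ∀ L : List (A ⊕ B), q (Monoid.Coprod.mk (FreeMonoid.ofList L)) = wordMap f g L := by
    intro L
    induction L with
    | nil => rfl
    | cons l L ih =>
      rw [FreeMonoid.ofList_cons, map_mul, map_mul, ih]
      cases l with
      | inl a => rw [wordMap_cons_inl]; rfl
      | inr b => rw [wordMap_cons_inr]; rfl
  have hpq : p.ker ≤ q.ker := by
    intro x hx
    obtain ⟨L, rfl⟩ := Monoid.Coprod.mk_surjective x
    rw [MonoidHom.mem_ker, ← FreeMonoid.ofList_toList L] at hx ⊢
    rw [hqL]
    refine wordMap_eq_one hCA hCB hC hfg _ ?_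
    rw [← hpL, hx, Subgroup.coe_one]
  refine ⟨p.liftOfSurjective hp ⟨q, hpq⟩, fun a => ?_, fun b => ?_⟩
  · exact (p.liftOfRightInverse_comp_apply _ _ ⟨q, hpq⟩ (Monoid.Coprod.inl a)).trans
      (Monoid.Coprod.lift_apply_inl f g a)
  · exact (p.liftOfRightInverse_comp_apply _ _ ⟨q, hpq⟩ (Monoid.Coprod.inr b)).trans
      (Monoid.Coprod.lift_apply_inr f g b)

end Amalgam

end FreeGroupRing

theorem isFinitelyNormallyGenerated_ker_of_isFreeGroup {ι A : Type*} [Finite ι] [Group A]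
    [IsFreeGroup A] {f : FreeGroup ι →* A} (hf : Function.Surjective f) :
    f.ker.IsFinitelyNormallyGenerated := by
  let σ : A →* FreeGroup ι := IsFreeGroup.lift fun x => Function.surjInv hf (IsFreeGroup.of x)
  have hσ : f.comp σ = MonoidHom.id A := by
    refine IsFreeGroup.ext_hom fun x => ?_
    exact (congrArg f (IsFreeGroup.lift_of _ x)).trans (Function.surjInv_eq hf _)
  have hσ' : ∀ a, f (σ a) = a := DFunLike.congr_fun hσ
  set S : Set (FreeGroup ι) := Set.range fun i => (FreeGroup.of i)⁻¹ * σ (f (FreeGroup.of i))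
    with hS
  refine ⟨S, Set.finite_range _, le_antisymm (Subgroup.normalClosure_le_normal ?_) fun x hx => ?_⟩
  · rintro _ ⟨i, rfl⟩
    simp [MonoidHom.mem_ker, hσ']
  · have h : QuotientGroup.mk' (Subgroup.normalClosure S) =
        ((QuotientGroup.mk' (Subgroup.normalClosure S)).comp σ).comp f := by
      ext i
      exact QuotientGroup.eq.2 (Subgroup.subset_normalClosure ⟨i, rfl⟩)
    rw [← QuotientGroup.ker_mk' (Subgroup.normalClosure S), MonoidHom.mem_ker, h,
      MonoidHom.comp_apply, MonoidHom.mem_ker.1 hx, map_one]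

theorem isFinitelyPresented_of_isFreeGroup {A : Type*} [Group A] [IsFreeGroup A] [Group.FG A] :
    Group.IsFinitelyPresented A := by
  obtain ⟨α, _, f, hf⟩ := Group.fg_iff_exists_freeGroup_hom_surjective_finite.1 ‹Group.FG A›
  exact Group.IsFinitelyPresented.of_surjective f hf
    (isFinitelyNormallyGenerated_ker_of_isFreeGroup hf)

section Ascending

variable {D G : Type*} [Group D] [Group G] {f : D →* G} {θ : D →* D} {t : G}

theorem pow_inv_mul_mul_pow_add (hθ : ∀ d, t * f d * t⁻¹ = f (θ d)) (a b k : ℕ) (d : D) :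
    ∃ d', (t ^ a)⁻¹ * f d * t ^ b = (t ^ (a + k))⁻¹ * f d' * t ^ (b + k) := by
  induction k with
  | zero => exact ⟨d, rfl⟩
  | succ k ih =>
    obtain ⟨d', h⟩ := ih
    refine ⟨θ d', ?_⟩
    rw [h, ← hθ, ← add_assoc, ← add_assoc, pow_succ' t (a + k), pow_succ' t (b + k)]
    group

theorem exists_eq_pow_inv_mul_mul_pow (hθ : ∀ d, t * f d * t⁻¹ = f (θ d)) {g : G}
    (hg : g ∈ Subgroup.closure (insert t (Set.range f))) :
    ∃ (a b : ℕ) (d : D), g = (t ^ a)⁻¹ * f d * t ^ b := by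
  induction hg using Subgroup.closure_induction with
  | mem x hx =>
    obtain rfl | ⟨d, rfl⟩ := hx
    · exact ⟨0, 1, 1, by simp⟩
    · exact ⟨0, 0, d, by simp⟩
  | one => exact ⟨0, 0, 1, by simp⟩
  | mul x y _ _ hx hy =>
    obtain ⟨a, b, d, rfl⟩ := hx
    obtain ⟨a', b', d', rfl⟩ := hy
    obtain ⟨c, hc⟩ := pow_inv_mul_mul_pow_add hθ a b a' d
    obtain ⟨c', hc'⟩ := pow_inv_mul_mul_pow_add hθ a' b' b d'
    refine ⟨a + a', b' + b, c * c', ?_⟩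
    rw [hc, hc', map_mul, add_comm a' b]
    group
  | inv x _ hx =>
    obtain ⟨a, b, d, rfl⟩ := hx
    exact ⟨b, a, d⁻¹, by rw [map_inv]; group⟩

end Ascending

namespace FreeGroupRing

variable {X : Type*} {r : ℕ} {θ : FreeGroup X →* FreeGroup X} {e : ℕ → Fin r → FreeGroup X}
  {Q : Type*} [Group Q] {t : Q} {b : Fin r → Q}

theorem map_orbitSubgroup_le (he : ∀ l k, θ (e l k) = e (l + 1) k) (n : ℕ) :
    (orbitSubgroup e n).map θ ≤ orbitSubgroup e (n + 1) := by
  rw [orbitSubgroup, MonoidHom.map_closure, Subgroup.closure_le]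
  rintro _ ⟨_, ⟨l, hl, k, rfl⟩, rfl⟩
  rw [he]
  exact mem_orbitSubgroup e (by omega) k

theorem orbitSubgroup_succ_le (he : ∀ l k, θ (e l k) = e (l + 1) k) (n : ℕ) :
    orbitSubgroup e (n + 1) ≤ orbitSubgroup e n ⊔ (orbitSubgroup e n).map θ := by
  rw [orbitSubgroup, Subgroup.closure_le]
  rintro _ ⟨l, hl, k, rfl⟩
  obtain rfl | hl := hl.eq_or_lt
  · exact Subgroup.mem_sup_right ⟨e n k, mem_orbitSubgroup e le_rfl k, he n k⟩
  · exact Subgroup.mem_sup_left (mem_orbitSubgroup e (by omega) k)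

theorem hom_orbitSubgroup_conj (he : ∀ l k, θ (e l k) = e (l + 1) k) {n : ℕ}
    {φ : orbitSubgroup e (n + 1) →* Q}
    (hφ : ∀ l k (hl : l ≤ n + 1), φ ⟨e l k, mem_orbitSubgroup e hl k⟩ = t ^ l * b k * (t ^ l)⁻¹)
    (x : FreeGroup X) (hx : x ∈ orbitSubgroup e n) :
    φ ⟨θ x, map_orbitSubgroup_le he n ⟨x, hx, rfl⟩⟩ =
      t * φ ⟨x, orbitSubgroup_mono e n.le_succ hx⟩ * t⁻¹ := by
  let f₁ : orbitSubgroup e n →* Q := φ.comp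
    ((θ.comp (orbitSubgroup e n).subtype).codRestrict (orbitSubgroup e (n + 1))
      fun x => map_orbitSubgroup_le he n ⟨x, x.2, rfl⟩)
  let f₂ : orbitSubgroup e n →* Q := (MulAut.conj t).toMonoidHom.comp
    (φ.comp (Subgroup.inclusion (orbitSubgroup_mono e n.le_succ)))
  suffices f₁ = f₂ from DFunLike.congr_fun this ⟨x, hx⟩
  refine MonoidHom.eq_of_eqOn_dense (Subgroup.closure_closure_coe_preimage (k := _)) ?_
  rintro ⟨_, _⟩ ⟨l, hl, k, rfl⟩
  have h1 : f₁ ⟨e l k, mem_orbitSubgroup e hl k⟩ =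
      φ ⟨e (l + 1) k, mem_orbitSubgroup e (by omega) k⟩ :=
    congrArg φ (Subtype.ext (he l k))
  have h2 : f₂ ⟨e l k, mem_orbitSubgroup e hl k⟩ =
      t * φ ⟨e l k, mem_orbitSubgroup e (by omega) k⟩ * t⁻¹ := rfl
  refine h1.trans (Eq.trans ?_ h2.symm)
  rw [hφ (l + 1) k (by omega), hφ l k (by omega), pow_succ']
  group

theorem exists_hom_orbitSubgroup_succ (hθ : Function.Injective θ)
    (he : ∀ l k, θ (e l k) = e (l + 1) k) {n : ℕ}
    (hn : ∀ u ∈ subgroupIdeal (orbitSubgroup e (n + 1) : Set (FreeGroup X)),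
      u ∈ subgroupIdeal (θ.range : Set (FreeGroup X)) →
      u ∈ subgroupIdeal ((orbitSubgroup e n).map θ : Set (FreeGroup X)))
    {φ : orbitSubgroup e (n + 1) →* Q}
    (hφ : ∀ l k (hl : l ≤ n + 1), φ ⟨e l k, mem_orbitSubgroup e hl k⟩ = t ^ l * b k * (t ^ l)⁻¹) :
    ∃ ψ : orbitSubgroup e (n + 2) →* Q, ∀ l k (hl : l ≤ n + 2),
      ψ ⟨e l k, mem_orbitSubgroup e hl k⟩ = t ^ l * b k * (t ^ l)⁻¹ := by
  let E := (orbitSubgroup e (n + 1)).equivMapOfInjective θ hθ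
  let g : (orbitSubgroup e (n + 1)).map θ →* Q :=
    (MulAut.conj t).toMonoidHom.comp (φ.comp E.symm.toMonoidHom)
  have hg : ∀ x (hx : x ∈ orbitSubgroup e (n + 1)),
      g ⟨θ x, Subgroup.mem_map_of_mem θ hx⟩ = t * φ ⟨x, hx⟩ * t⁻¹ := fun x hx => by
    have : E.symm ⟨θ x, Subgroup.mem_map_of_mem θ hx⟩ = ⟨x, hx⟩ := E.symm_apply_eq.2 rfl
    simp [g, this]
  obtain ⟨ψ, hψl, hψr⟩ := exists_hom_sup (f := φ) (g := g) (map_orbitSubgroup_le he n)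
    (Subgroup.map_mono (orbitSubgroup_mono e n.le_succ))
    (fun u hu hu' => hn u hu (subgroupIdeal_mono (by
      rintro _ ⟨x, -, rfl⟩; exact ⟨x, rfl⟩) hu'))
    (by
      rintro _ ⟨x, hx, rfl⟩
      rw [hom_orbitSubgroup_conj he hφ x hx]
      exact (hg x _).symm)
  refine ⟨ψ.comp (Subgroup.inclusion (orbitSubgroup_succ_le he (n + 1))), fun l k hl => ?_⟩
  obtain rfl | hl := hl.eq_or_lt
  · refine (congrArg ψ (Subtype.ext (he (n + 1) k).symm)).trans
      ((hψr ⟨_, Subgroup.mem_map_of_mem θ (mem_orbitSubgroup e (le_refl (n + 1)) k)⟩).trans ?_)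
    rw [hg _ (mem_orbitSubgroup e le_rfl k), hφ (n + 1) k le_rfl, pow_succ' t (n + 1)]
    group
  · exact (hψl ⟨e l k, mem_orbitSubgroup e (by omega) k⟩).trans (hφ l k (by omega))

theorem exists_hom_of_hom_orbitSubgroup (hθ : Function.Injective θ)
    (he : ∀ l k, θ (e l k) = e (l + 1) k)
    (hgen : Subgroup.closure {g | ∃ l k, e l k = g} = ⊤) {j : ℕ}
    (hj : ∀ n ≥ j, ∀ u ∈ subgroupIdeal (orbitSubgroup e (n + 1) : Set (FreeGroup X)),
      u ∈ subgroupIdeal (θ.range : Set (FreeGroup X)) →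
      u ∈ subgroupIdeal ((orbitSubgroup e n).map θ : Set (FreeGroup X)))
    {φ : orbitSubgroup e (j + 1) →* Q}
    (hφ : ∀ l k (hl : l ≤ j + 1), φ ⟨e l k, mem_orbitSubgroup e hl k⟩ = t ^ l * b k * (t ^ l)⁻¹) :
    ∃ Φ : FreeGroup X →* Q, ∀ l k, Φ (e l k) = t ^ l * b k * (t ^ l)⁻¹ := by
  have hex : ∀ n ≥ j, ∃ ψ : orbitSubgroup e (n + 1) →* Q, ∀ l k (hl : l ≤ n + 1),
      ψ ⟨e l k, mem_orbitSubgroup e hl k⟩ = t ^ l * b k * (t ^ l)⁻¹ := by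
    intro n hn
    induction n, hn using Nat.le_induction with
    | base => exact ⟨φ, hφ⟩
    | succ n hn ih =>
      obtain ⟨ψ, hψ⟩ := ih
      exact exists_hom_orbitSubgroup_succ hθ he (hj n hn) hψ
  let p : FreeGroup (ℕ × Fin r) →* FreeGroup X := FreeGroup.lift fun x => e x.1 x.2
  let q : FreeGroup (ℕ × Fin r) →* Q := FreeGroup.lift fun x => t ^ x.1 * b x.2 * (t ^ x.1)⁻¹
  have hp : Function.Surjective p := by
    rw [← MonoidHom.range_eq_top, eq_top_iff, ← hgen, Subgroup.closure_le]
    rintro _ ⟨l, k, rfl⟩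
    exact ⟨FreeGroup.of (l, k), by simp [p]⟩
  have key : ∀ w, ∃ n, ∀ m ≥ n, ∃ h : p w ∈ orbitSubgroup e m, ∀ ψ : orbitSubgroup e m →* Q,
      (∀ l k (hl : l ≤ m), ψ ⟨e l k, mem_orbitSubgroup e hl k⟩ = t ^ l * b k * (t ^ l)⁻¹) →
      ψ ⟨p w, h⟩ = q w := by
    intro w
    induction w using FreeGroup.induction_on with
    | C1 => exact ⟨0, fun m _ => ⟨by rw [map_one]; exact one_mem _, fun ψ _ => by
        simp only [map_one]; exact map_one ψ⟩⟩
    | of x => exact ⟨x.1, fun m hm => ⟨by simpa [p] using mem_orbitSubgroup e hm x.2,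
        fun ψ hψ => by simpa [p, q] using hψ x.1 x.2 hm⟩⟩
    | inv_of x ih =>
      obtain ⟨n, hn⟩ := ih
      refine ⟨n, fun m hm => ?_⟩
      obtain ⟨h, hψ⟩ := hn m hm
      refine ⟨by rw [map_inv]; exact inv_mem h, fun ψ hψ' => ?_⟩
      rw [map_inv q, ← hψ ψ hψ']
      exact (congrArg ψ (Subtype.ext (map_inv p _))).trans (map_inv ψ ⟨_, h⟩)
    | mul x y hx hy =>
      obtain ⟨n, hn⟩ := hx
      obtain ⟨n', hn'⟩ := hy
      refine ⟨max n n', fun m hm => ?_⟩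
      obtain ⟨h, hψ⟩ := hn m (le_of_max_le_left hm)
      obtain ⟨h', hψ'⟩ := hn' m (le_of_max_le_right hm)
      refine ⟨by rw [map_mul]; exact mul_mem h h', fun ψ hψ'' => ?_⟩
      rw [map_mul q, ← hψ ψ hψ'', ← hψ' ψ hψ'']
      exact (congrArg ψ (Subtype.ext (map_mul p _ _))).trans (map_mul ψ ⟨_, h⟩ ⟨_, h'⟩)
  have hpq : p.ker ≤ q.ker := by
    intro w hw
    rw [MonoidHom.mem_ker] at hw ⊢
    obtain ⟨n, hn⟩ := key w
    obtain ⟨ψ, hψ⟩ := hex (max n j) (le_max_right _ _)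
    obtain ⟨h, h'⟩ := hn (max n j + 1) (by omega)
    rw [← h' ψ hψ, ← map_one ψ]
    exact congrArg ψ (Subtype.ext hw)
  refine ⟨p.liftOfSurjective hp ⟨q, hpq⟩, fun l k => ?_⟩
  have h1 := p.liftOfRightInverse_comp_apply _ (Function.rightInverse_surjInv hp) ⟨q, hpq⟩
    (FreeGroup.of (l, k))
  simpa [p, q] using h1

theorem isFinitelyPresented_of_closure_eq_top {K : Type*} [Group K] {f : FreeGroup X →* K}
    (hf : Function.Injective f) {s : K} (hθ : ∀ d, s * f d * s⁻¹ = f (θ d))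
    (he : ∀ l k, θ (e l k) = e (l + 1) k)
    (hgen : Subgroup.closure {g | ∃ l k, e l k = g} = ⊤)
    (hK : Subgroup.closure (insert s (Set.range fun k => f (e 0 k))) = ⊤)
    {τ : K →* Multiplicative ℤ} (hτ : ∀ d, τ (f d) = 1) (hs : τ s ≠ 1) :
    Group.IsFinitelyPresented K := by
  have hθinj : Function.Injective θ := fun x y hxy => hf <| by
    have := (hθ x).trans ((congrArg f hxy).trans (hθ y).symm)
    exact mul_left_cancel (mul_right_cancel this)
  obtain ⟨j, hj⟩ := exists_forall_mem_subgroupIdeal hθinj he hgen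
  have hfe : ∀ l k, f (e l k) = s ^ l * f (e 0 k) * (s ^ l)⁻¹ := by
    intro l k
    induction l with
    | zero => simp
    | succ l ih => rw [← he, ← hθ, ih, pow_succ']; group
  let T : FreeGroup (Option (Fin r)) := FreeGroup.of none
  let E : Fin r → FreeGroup (Option (Fin r)) := fun k => FreeGroup.of (some k)
  let π : FreeGroup (Option (Fin r)) →* K :=
    FreeGroup.lift fun o => o.elim s fun k => f (e 0 k)
  have hπT : π T = s := FreeGroup.lift_apply_of
  have hπE : ∀ k, π (E k) = f (e 0 k) := fun k => FreeGroup.lift_apply_of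
  have hπ : Function.Surjective π := by
    rw [← MonoidHom.range_eq_top, eq_top_iff, ← hK, Subgroup.closure_le]
    rintro _ (rfl | ⟨k, rfl⟩)
    · exact ⟨T, hπT⟩
    · exact ⟨E k, hπE k⟩
  let v : FreeGroup (Fin (j + 2) × Fin r) →* FreeGroup (Option (Fin r)) :=
    FreeGroup.lift fun x => T ^ (x.1 : ℕ) * E x.2 * (T ^ (x.1 : ℕ))⁻¹
  let p : FreeGroup (Fin (j + 2) × Fin r) →* orbitSubgroup e (j + 1) :=
    FreeGroup.lift fun x => ⟨e x.1 x.2, mem_orbitSubgroup e (Nat.lt_succ_iff.1 x.1.2) x.2⟩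
  have hpo : ∀ (l : ℕ) (k : Fin r) (hl : l ≤ j + 1),
      p (FreeGroup.of (⟨l, Nat.lt_succ_iff.2 hl⟩, k)) = ⟨e l k, mem_orbitSubgroup e hl k⟩ :=
    fun l k hl => FreeGroup.lift_apply_of
  have hp : Function.Surjective p := by
    rw [← MonoidHom.range_eq_top]
    refine Subgroup.map_injective (orbitSubgroup e (j + 1)).subtype_injective ?_
    rw [← MonoidHom.range_eq_map, Subgroup.range_subtype]
    refine le_antisymm (Subgroup.map_subtype_le _) ?_
    refine (Subgroup.closure_le _).2 ?_
    rintro _ ⟨l, hl, k, rfl⟩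
    exact ⟨⟨e l k, mem_orbitSubgroup e hl k⟩, ⟨_, hpo l k hl⟩, rfl⟩
  have hπv : π.comp v = f.comp ((orbitSubgroup e (j + 1)).subtype.comp p) := by
    ext x
    simp [v, p, hπT, hπE, hfe x.1]
  obtain ⟨S, hS, hSp⟩ := isFinitelyNormallyGenerated_ker_of_isFreeGroup hp
  set N := Subgroup.normalClosure (v '' S) with hN
  have hNπ : N ≤ π.ker := by
    refine Subgroup.normalClosure_le_normal ?_
    rintro _ ⟨x, hx, rfl⟩
    have hx' : p x = 1 := by
      rw [← MonoidHom.mem_ker, ← hSp]; exact Subgroup.subset_normalClosure hx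
    have := DFunLike.congr_fun hπv x
    simpa [hx'] using this
  refine Group.IsFinitelyPresented.of_surjective π hπ
    ⟨v '' S, hS.image v, le_antisymm hNπ fun x hx => ?_⟩
  let mk := QuotientGroup.mk' N
  have hker : p.ker ≤ (mk.comp v).ker := by
    rw [← hSp]
    refine Subgroup.normalClosure_le_normal fun x hx => ?_
    exact (QuotientGroup.eq_one_iff _).2 (Subgroup.subset_normalClosure ⟨x, hx, rfl⟩)
  obtain ⟨Φ, hΦ⟩ := exists_hom_of_hom_orbitSubgroup (t := mk T) (b := fun k => mk (E k)) hθinj he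
    hgen hj (φ := p.liftOfSurjective hp ⟨mk.comp v, hker⟩) (fun l k hl => by
      rw [← hpo l k hl]
      refine (p.liftOfRightInverse_comp_apply _ (Function.rightInverse_surjInv hp)
        ⟨mk.comp v, hker⟩ _).trans ?_
      simp [v])
  let π' : FreeGroup (Option (Fin r)) ⧸ N →* K := QuotientGroup.lift N π hNπ
  have hπ' : ∀ y, π' (mk y) = π y := fun y => rfl
  have hΦθ : ∀ d, mk T * Φ d * (mk T)⁻¹ = Φ (θ d) := by
    suffices (MulAut.conj (mk T)).toMonoidHom.comp Φ = Φ.comp θ from DFunLike.congr_fun this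
    refine MonoidHom.eq_of_eqOn_dense hgen ?_
    rintro _ ⟨l, k, rfl⟩
    change mk T * Φ (e l k) * (mk T)⁻¹ = Φ (θ (e l k))
    rw [he, hΦ, hΦ, pow_succ']
    group
  have hΦf : ∀ d, π' (Φ d) = f d := by
    suffices π'.comp Φ = f from DFunLike.congr_fun this
    refine MonoidHom.eq_of_eqOn_dense hgen ?_
    rintro _ ⟨l, k, rfl⟩
    simp only [MonoidHom.comp_apply, hΦ, map_mul, map_inv, map_pow, hπ', hπT, hπE, hfe l]
  have htop : Subgroup.closure (insert (mk T) (Set.range Φ)) = ⊤ := by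
    rw [eq_top_iff, ← MonoidHom.range_eq_top.2 (QuotientGroup.mk'_surjective N),
      MonoidHom.range_eq_map, ← FreeGroup.closure_range_of, MonoidHom.map_closure,
      Subgroup.closure_le]
    rintro _ ⟨_, ⟨o, rfl⟩, rfl⟩
    cases o with
    | none => exact Subgroup.subset_closure (Set.mem_insert _ _)
    | some k =>
      refine Subgroup.subset_closure (Set.mem_insert_of_mem _ ⟨e 0 k, ?_⟩)
      rw [hΦ]
      simp [E, mk]
  obtain ⟨a, b, d, h⟩ := exists_eq_pow_inv_mul_mul_pow (g := mk x) hΦθ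
    (htop ▸ Subgroup.mem_top _)
  have h1 : (s ^ a)⁻¹ * f d * s ^ b = 1 := by
    have := congrArg π' h
    rw [hπ', MonoidHom.mem_ker.1 hx] at this
    simpa [hΦf, hπ', hπT] using this.symm
  have h2 : a = b := by
    have := congrArg τ h1
    rw [map_mul, map_mul, hτ, map_inv, map_pow, map_pow, mul_one, map_one,
      inv_mul_eq_one] at this
    exact injective_pow_iff_not_isOfFinOrder.2 (by rwa [isOfFinOrder_iff_eq_one]) this
  subst h2
  have h3 : d = 1 := by
    rw [mul_assoc, inv_mul_eq_one, eq_comm, mul_eq_right] at h1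
    exact hf (h1.trans (map_one f).symm)
  rw [h3, map_one, mul_one, inv_mul_cancel] at h
  exact (QuotientGroup.eq_one_iff x).1 h

end FreeGroupRing

section Ascending

variable {D G : Type*} [Group D] [Group G] {f : D →* G} {θ : D →* D}

theorem exists_forall_eq_pow_inv_mul_mul_pow {t : G} (hθ : ∀ d, t * f d * t⁻¹ = f (θ d))
    (hgen : Subgroup.closure (insert t (Set.range f)) = ⊤) {S : Set G} (hS : S.Finite) :
    ∃ m : ℕ, ∀ g ∈ S, ∃ (b : ℕ) (d : D), g = (t ^ m)⁻¹ * f d * t ^ b := by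
  choose a b d h using fun g => exists_eq_pow_inv_mul_mul_pow (g := g) hθ
    (hgen ▸ Subgroup.mem_top g)
  obtain ⟨m, hm⟩ := (hS.image a).bddAbove
  refine ⟨m, fun g hg => ?_⟩
  obtain ⟨k, rfl⟩ := Nat.exists_eq_add_of_le (hm ⟨g, hg, rfl⟩)
  obtain ⟨d', hd'⟩ := pow_inv_mul_mul_pow_add hθ (a g) (b g) k (d g)
  exact ⟨_, d', (h g).trans hd'⟩

theorem exists_pos_generator {τ : G →* Multiplicative ℤ} {K : Subgroup G}
    (hK : ¬ ∀ k ∈ K, τ k = 1) :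
    ∃ s ∈ K, ∃ n : ℕ, 0 < n ∧ τ s = Multiplicative.ofAdd (n : ℤ) ∧
      ∀ k ∈ K, ∃ q : ℤ, τ k = τ s ^ q := by
  obtain ⟨⟨_, s, hs, rfl⟩, hgen⟩ := IsCyclic.exists_generator (α := K.map τ)
  have hgen' : ∀ k ∈ K, ∃ q : ℤ, τ k = τ s ^ q := fun k hk => by
    obtain ⟨q, hq⟩ := hgen ⟨τ k, k, hk, rfl⟩
    exact ⟨q, (congrArg Subtype.val hq).symm⟩
  obtain ⟨n, hn | hn⟩ := Int.eq_nat_or_neg (Multiplicative.toAdd (τ s))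
  all_goals
    have hn0 : 0 < n := by
      refine Nat.pos_of_ne_zero fun h => hK fun k hk => ?_
      obtain ⟨q, hq⟩ := hgen' k hk
      have : τ s = 1 := Multiplicative.toAdd.injective (by simp [hn, h])
      rw [hq, this, one_zpow]
  · exact ⟨s, hs, n, hn0, Multiplicative.toAdd.injective hn, hgen'⟩
  · refine ⟨s⁻¹, inv_mem hs, n, hn0, Multiplicative.toAdd.injective (by simp [hn]), fun k hk => ?_⟩
    obtain ⟨q, hq⟩ := hgen' k hk
    exact ⟨-q, by simpa using hq⟩

theorem exists_pow_conj {t : G} (hθ : ∀ d, t * f d * t⁻¹ = f (θ d)) (n : ℕ) :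
    ∃ θ' : D →* D, ∀ d, t ^ n * f d * (t ^ n)⁻¹ = f (θ' d) := by
  induction n with
  | zero => exact ⟨MonoidHom.id D, fun d => by simp⟩
  | succ n ih =>
    obtain ⟨θ', h⟩ := ih
    exact ⟨θ.comp θ', fun d => by rw [MonoidHom.comp_apply, ← hθ, ← h, pow_succ']; group⟩

variable [IsFreeGroup D]

theorem isFinitelyPresented_of_closure_eq_top {r : ℕ} {e : ℕ → Fin r → D}
    (hf : Function.Injective f) {s : G} (hθ : ∀ d, s * f d * s⁻¹ = f (θ d))
    (he : ∀ l k, θ (e l k) = e (l + 1) k)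
    (hgen : Subgroup.closure {g | ∃ l k, e l k = g} = ⊤)
    (hG : Subgroup.closure (insert s (Set.range fun k => f (e 0 k))) = ⊤)
    {τ : G →* Multiplicative ℤ} (hτ : ∀ d, τ (f d) = 1) (hs : τ s ≠ 1) :
    Group.IsFinitelyPresented G := by
  let E := IsFreeGroup.toFreeGroup D
  refine FreeGroupRing.isFinitelyPresented_of_closure_eq_top
    (f := f.comp E.symm.toMonoidHom) (hf.comp E.symm.injective) (s := s)
    (θ := E.toMonoidHom.comp (θ.comp E.symm.toMonoidHom)) (e := fun l k => E (e l k))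
    (fun d => by simpa using hθ (E.symm d)) (fun l k => by simp [he]) ?_ (by simpa using hG)
    (fun d => hτ _) hs
  have h := congrArg (Subgroup.map E.toMonoidHom) hgen
  rw [MonoidHom.map_closure, ← MonoidHom.range_eq_map, MonoidHom.range_eq_top.2 E.surjective] at h
  rw [← h]
  congr 1
  ext g
  simp only [Set.mem_image, Set.mem_ofPred_eq]
  constructor
  · rintro ⟨l, k, rfl⟩
    exact ⟨_, ⟨l, k, rfl⟩, rfl⟩
  · rintro ⟨_, ⟨l, k, rfl⟩, rfl⟩
    exact ⟨l, k, rfl⟩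

theorem isFreeGroup_of_le_range (hf : Function.Injective f) {K : Subgroup G} (hK : K ≤ f.range) :
    IsFreeGroup K := by
  have h : (K.comap f).map f = K := by rw [Subgroup.map_comap_eq, inf_eq_right.2 hK]
  have : IsFreeGroup (K.comap f) := subgroupIsFreeOfIsFree _
  exact IsFreeGroup.ofMulEquiv
    (((K.comap f).equivMapOfInjective f hf).trans (MulEquiv.subgroupCongr h))

theorem isFinitelyPresented_closure_insert {r : ℕ} (hf : Function.Injective f) {s : G}
    (hθ : ∀ d, s * f d * s⁻¹ = f (θ d)) {τ : G →* Multiplicative ℤ} (hτ : ∀ d, τ (f d) = 1)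
    (hs : τ s ≠ 1) (b : Fin r → D) :
    Group.IsFinitelyPresented (Subgroup.closure (insert s (Set.range fun k => f (b k)))) := by
  set K := Subgroup.closure (insert s (Set.range fun k => f (b k))) with hK
  let e : ℕ → Fin r → D := fun l k => θ^[l] (b k)
  have he : ∀ l k, θ (e l k) = e (l + 1) k := fun l k => (Function.iterate_succ_apply' θ l _).symm
  set B := Subgroup.closure {g | ∃ l k, e l k = g} with hB
  have : IsFreeGroup B := subgroupIsFreeOfIsFree _
  have heB : ∀ l k, e l k ∈ B := fun l k => Subgroup.subset_closure ⟨l, k, rfl⟩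
  have hsK : s ∈ K := Subgroup.subset_closure (Set.mem_insert _ _)
  have heK : ∀ l k, f (e l k) ∈ K := by
    intro l k
    induction l with
    | zero => exact Subgroup.subset_closure (Set.mem_insert_of_mem _ ⟨k, rfl⟩)
    | succ l ih =>
      rw [← he, ← hθ]
      exact mul_mem (mul_mem hsK ih) (inv_mem hsK)
  have hBK : B ≤ K.comap f := by
    rw [hB, Subgroup.closure_le]
    rintro _ ⟨l, k, rfl⟩
    exact heK l k
  have hBB : B ≤ B.comap θ := by
    conv_lhs => rw [hB]
    rw [Subgroup.closure_le]
    rintro _ ⟨l, k, rfl⟩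
    exact Subgroup.mem_comap.2 ((he l k).symm ▸ heB (l + 1) k)
  refine isFinitelyPresented_of_closure_eq_top
    (f := (f.comp B.subtype).codRestrict K fun x => hBK x.2)
    (θ := (θ.comp B.subtype).codRestrict B fun x => hBB x.2)
    (e := fun l k => ⟨e l k, heB l k⟩) (s := ⟨s, hsK⟩) (τ := τ.comp K.subtype)
    (fun x y h => Subtype.ext (hf (congrArg Subtype.val h)))
    (fun d => Subtype.ext (hθ d)) (fun l k => Subtype.ext (he l k)) ?_ ?_ (fun d => hτ d) hs
  · convert Subgroup.closure_closure_coe_preimage (k := {g | ∃ l k, e l k = g}) using 2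
    ext x
    exact exists₂_congr fun l k => Subtype.ext_iff
  · convert Subgroup.closure_closure_coe_preimage (k := insert s (Set.range fun k => f (b k)))
      using 2
    ext ⟨x, hx⟩
    simp only [Set.mem_insert_iff, Set.mem_range, Subtype.ext_iff, Set.mem_preimage]
    rfl

/-- **Feighn and Handel**: ascending HNN extensions of free groups are coherent. -/
theorem isFinitelyPresented_of_fg {t : G} (hf : Function.Injective f)
    (hθ : ∀ d, t * f d * t⁻¹ = f (θ d))
    (hgen : Subgroup.closure (insert t (Set.range f)) = ⊤)
    {τ : G →* Multiplicative ℤ} (hτ : ∀ d, τ (f d) = 1) (ht : τ t = Multiplicative.ofAdd 1)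
    {K : Subgroup G} (hK : K.FG) : Group.IsFinitelyPresented K := by
  obtain ⟨S, hSK, hS⟩ := (Subgroup.fg_iff K).1 hK
  have hτm : ∀ (m b : ℕ) (d : D), τ ((t ^ m)⁻¹ * f d * t ^ b) =
      Multiplicative.ofAdd ((b : ℤ) - m) := by
    intro m b d
    apply Multiplicative.toAdd.injective
    simp [hτ, ht]
    ring
  by_cases hKτ : ∀ k ∈ K, τ k = 1
  · obtain ⟨m, hm⟩ := exists_forall_eq_pow_inv_mul_mul_pow hθ hgen hS
    have hKr : K ≤ ((MulAut.conj (t ^ m)⁻¹).toMonoidHom.comp f).range := by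
      rw [← hSK, Subgroup.closure_le]
      intro g hg
      obtain ⟨b, d, rfl⟩ := hm g hg
      have h1 := hKτ _ (hSK ▸ Subgroup.subset_closure hg)
      rw [hτm, ofAdd_eq_one, sub_eq_zero, Nat.cast_inj] at h1
      refine ⟨d, ?_⟩
      change (t ^ m)⁻¹ * f d * (t ^ m)⁻¹⁻¹ = _
      rw [h1, inv_inv]
    have := isFreeGroup_of_le_range ((MulAut.conj (t ^ m)⁻¹).injective.comp hf) hKr
    have : Group.FG K := (Group.fg_iff_subgroup_fg K).2 hK
    exact isFinitelyPresented_of_isFreeGroup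
  · obtain ⟨s, hs, n, hn, hsn, hgenK⟩ := exists_pos_generator hKτ
    obtain ⟨m, hm⟩ := exists_forall_eq_pow_inv_mul_mul_pow hθ hgen (hS.insert s)
    let c := (MulAut.conj (t ^ m)).toMonoidHom
    have hcτ : ∀ g, τ (c g) = τ g := fun g => by
      change τ (t ^ m * g * (t ^ m)⁻¹) = τ g
      rw [map_mul, map_mul, mul_right_comm, ← map_mul, mul_inv_cancel, map_one, one_mul]
    have hc : ∀ g ∈ insert s S, ∃ d : D, c g = f d * t ^ Multiplicative.toAdd (τ g) := by
      intro g hg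
      obtain ⟨b, d, rfl⟩ := hm g hg
      refine ⟨d, ?_⟩
      rw [hτm, toAdd_ofAdd, zpow_sub, zpow_natCast, zpow_natCast]
      change t ^ m * ((t ^ m)⁻¹ * f d * t ^ b) * (t ^ m)⁻¹ = _
      group
    obtain ⟨d₀, hd₀⟩ := hc s (Set.mem_insert _ _)
    rw [hsn, toAdd_ofAdd, zpow_natCast] at hd₀
    obtain ⟨θn, hθn⟩ := exists_pow_conj hθ n
    have hθ' : ∀ d, c s * f d * (c s)⁻¹ = f (((MulAut.conj d₀).toMonoidHom.comp θn) d) := by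
      intro d
      change _ = f (d₀ * θn d * d₀⁻¹)
      rw [map_mul, map_mul, ← hθn, map_inv, hd₀]
      group
    obtain ⟨r, γ, -, hγ⟩ := hS.fin_param
    have hcl : ∀ k, c (γ k) ∈ Subgroup.closure (insert (c s) (Set.range f)) := by
      intro k
      have hk : γ k ∈ S := hγ ▸ Set.mem_range_self k
      have hf' : ∀ d, f d ∈ Subgroup.closure (insert (c s) (Set.range f)) := fun d =>
        Subgroup.subset_closure (Set.mem_insert_of_mem _ ⟨d, rfl⟩)
      obtain ⟨d, hd⟩ := hc _ (Set.mem_insert_of_mem _ hk)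
      obtain ⟨q, hq⟩ := hgenK _ (hSK ▸ Subgroup.subset_closure hk)
      rw [hd, hq, hsn, ← ofAdd_zsmul, toAdd_ofAdd, smul_eq_mul, mul_comm, zpow_mul, zpow_natCast,
        eq_inv_mul_of_mul_eq hd₀.symm]
      exact mul_mem (hf' d) (zpow_mem (mul_mem (inv_mem (hf' d₀))
        (Subgroup.subset_closure (Set.mem_insert _ _))) q)
    choose a b d hd using fun k => exists_eq_pow_inv_mul_mul_pow hθ' (hcl k)
    have hKc : Subgroup.closure (insert (c s) (Set.range fun k => f (d k))) = K.map c := by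
      refine le_antisymm ((Subgroup.closure_le _).2 ?_) ?_
      · have hcs : c s ∈ K.map c := ⟨s, hs, rfl⟩
        rintro _ (rfl | ⟨k, rfl⟩)
        · exact hcs
        · have hk : c (γ k) ∈ K.map c :=
            ⟨γ k, hSK ▸ Subgroup.subset_closure (hγ ▸ Set.mem_range_self k), rfl⟩
          have h : f (d k) = c s ^ a k * c (γ k) * (c s ^ b k)⁻¹ := by rw [hd]; group
          change f (d k) ∈ K.map c
          rw [h]
          exact mul_mem (mul_mem (pow_mem hcs _) hk) (inv_mem (pow_mem hcs _))
      · rw [← hSK, MonoidHom.map_closure, Subgroup.closure_le, ← hγ]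
        rintro _ ⟨_, ⟨k, rfl⟩, rfl⟩
        have hcs : c s ∈ Subgroup.closure (insert (c s) (Set.range fun k => f (d k))) :=
          Subgroup.subset_closure (Set.mem_insert _ _)
        rw [hd, SetLike.mem_coe]
        exact mul_mem (mul_mem (inv_mem (pow_mem hcs _))
          (Subgroup.subset_closure (Set.mem_insert_of_mem _ ⟨k, rfl⟩))) (pow_mem hcs _)
    have hfp := isFinitelyPresented_closure_insert hf hθ' hτ (s := c s) (by
      rw [hcτ, hsn, Ne, ofAdd_eq_one]
      omega) d
    rw [hKc] at hfp
    exact hfp.equiv (K.equivMapOfInjective c (MulAut.conj (t ^ m)).injective).symm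

end Ascending

open Monoid in
theorem coprodI_lift_of_comp_injective {ι : Type*} {M N : ι → Type*} [∀ i, Group (M i)]
    [∀ i, Group (N i)] {f : ∀ i, M i →* N i} (hf : ∀ i, Function.Injective (f i)) :
    Function.Injective (CoprodI.lift fun i => CoprodI.of.comp (f i)) := by
  classical
  have hword : ∀ w : CoprodI.Word M, ∃ w' : CoprodI.Word N,
      w'.toList = w.toList.map (fun x => ⟨x.1, f x.1 x.2⟩) ∧
      w'.prod = CoprodI.lift (fun i => CoprodI.of.comp (f i)) w.prod := by
    intro w
    refine ⟨⟨w.toList.map fun x => ⟨x.1, f x.1 x.2⟩, ?_, ?_⟩, rfl, ?_⟩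
    · intro l hl
      obtain ⟨x, hx, rfl⟩ := List.mem_map.1 hl
      exact fun h => w.ne_one x hx ((map_eq_one_iff _ (hf _)).1 h)
    · exact (List.isChain_map _).2 w.chain_ne
    · simp [CoprodI.Word.prod, map_list_prod, Function.comp_def]
  refine (injective_iff_map_eq_one _).2 fun x hx => ?_
  obtain ⟨w', hw', hprod⟩ := hword (CoprodI.Word.equiv x)
  rw [show (CoprodI.Word.equiv x).prod = x from CoprodI.Word.equiv.symm_apply_apply x, hx,
    ← CoprodI.Word.prod_empty] at hprod
  have h1 : w' = CoprodI.Word.empty := CoprodI.Word.equiv.symm.injective hprod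
  have h2 : CoprodI.Word.equiv x = CoprodI.Word.empty := by
    apply CoprodI.Word.ext
    rw [h1] at hw'
    exact List.map_eq_nil_iff.1 hw'.symm
  rw [← CoprodI.Word.equiv.symm_apply_apply x, h2]
  exact CoprodI.Word.prod_empty

/-- The inclusion of the `n`-th factor into the free product of countably many copies of `F`. -/
abbrev copyHom (F : Type*) [Group F] (n : ℕ) : F →* Monoid.CoprodI (fun _ : ℕ => F) :=
  Monoid.CoprodI.of (M := fun _ : ℕ => F) (i := n)

section FreeFactor

open Monoid

variable {F : Type*} [Group F] {H K : Subgroup F}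

theorem hom_ext_of_bijective {G : Type*} [Group G]
    (hHK : Function.Bijective (Coprod.lift H.subtype K.subtype)) {f g : F →* G}
    (hH : ∀ h : H, f h = g h) (hK : ∀ k : K, f k = g k) : f = g := by
  rw [← MonoidHom.cancel_right hHK.2]
  ext x
  · exact hH x
  · exact hK x

theorem exists_hom_of_bijective {G : Type*} [Group G]
    (hHK : Function.Bijective (Coprod.lift H.subtype K.subtype)) (f : H →* G) (g : K →* G) :
    ∃ φ : F →* G, (∀ h : H, φ h = f h) ∧ ∀ k : K, φ k = g k := by
  let E := MulEquiv.ofBijective _ hHK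
  refine ⟨(Coprod.lift f g).comp E.symm.toMonoidHom, fun h => ?_, fun k => ?_⟩
  · have : E.symm h = Coprod.inl h :=
      E.symm_apply_eq.2 (Coprod.lift_apply_inl H.subtype K.subtype h).symm
    simp [this]
  · have : E.symm k = Coprod.inr k :=
      E.symm_apply_eq.2 (Coprod.lift_apply_inr H.subtype K.subtype k).symm
    simp [this]

/-- The factors of the free product decomposition of `CoprodI fun _ : ℕ => F` induced by a
decomposition `F = H ∗ K` of its first factor. -/
def refinedFactor (H K : Subgroup F) : ℕ → Subgroup F
  | 0 => H
  | 1 => K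
  | _ + 2 => ⊤

theorem exists_injective_hom_coprodI
    (hHK : Function.Bijective (Coprod.lift H.subtype K.subtype)) {Ψ : H →* F}
    (hΨ : Function.Injective Ψ) :
    ∃ θ : CoprodI (fun _ : ℕ => F) →* CoprodI (fun _ : ℕ => F), Function.Injective θ ∧
      (∀ h : H, θ (copyHom F 0 (h : F)) = copyHom F 0 (Ψ h)) ∧
      (∀ k : K, θ (copyHom F 0 (k : F)) = copyHom F 1 (k : F)) ∧
      ∀ n x, θ (copyHom F (n + 1) x) = copyHom F (n + 2) x := by
  let S := refinedFactor H K
  let f : ∀ i, S i →* F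
    | 0 => Ψ
    | 1 => K.subtype
    | _ + 2 => Subgroup.subtype ⊤
  have hf : ∀ i, Function.Injective (f i)
    | 0 => hΨ
    | 1 => K.subtype_injective
    | _ + 2 => Subgroup.subtype_injective _
  obtain ⟨σ₀, hσH, hσK⟩ := exists_hom_of_bijective hHK
    (CoprodI.of (M := fun i => S i) (i := 0)) (CoprodI.of (M := fun i => S i) (i := 1))
  let σ : CoprodI (fun _ : ℕ => F) →* CoprodI (fun i => S i) := CoprodI.lift fun
    | 0 => σ₀
    | n + 1 => (CoprodI.of (M := fun i => S i) (i := n + 2)).comp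
        (Subgroup.topEquiv (G := F)).symm.toMonoidHom
  let ρ : CoprodI (fun i => S i) →* CoprodI (fun _ : ℕ => F) := CoprodI.lift fun
    | 0 => (copyHom F 0).comp H.subtype
    | 1 => (copyHom F 0).comp K.subtype
    | n + 2 => (copyHom F (n + 1)).comp (Subgroup.subtype ⊤)
  have hσ0 : ∀ x, σ (copyHom F 0 x) = σ₀ x := fun x => CoprodI.lift_of _ _
  have hσ1 : ∀ n x, σ (copyHom F (n + 1) x) =
      CoprodI.of (M := fun i => S i) (i := n + 2) ⟨x, Subgroup.mem_top x⟩ :=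
    fun n x => CoprodI.lift_of _ _
  have hρσ : ρ.comp σ = MonoidHom.id _ := by
    refine CoprodI.ext_hom _ _ fun i => ?_
    cases i with
    | zero =>
      refine hom_ext_of_bijective hHK (fun h => ?_) fun k => ?_
      · simp only [MonoidHom.comp_apply, hσ0, hσH]
        exact CoprodI.lift_of _ _
      · simp only [MonoidHom.comp_apply, hσ0, hσK]
        exact CoprodI.lift_of _ _
    | succ n =>
      ext x
      simp only [MonoidHom.comp_apply, hσ1]
      exact CoprodI.lift_of _ _
  refine ⟨(CoprodI.lift fun i => (copyHom F i).comp (f i)).comp σ,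
    (coprodI_lift_of_comp_injective (M := fun i => S i) (N := fun _ => F) hf).comp
      (Function.LeftInverse.injective (DFunLike.congr_fun hρσ)), fun h => ?_, fun k => ?_,
      fun n x => ?_⟩
  · rw [MonoidHom.comp_apply, hσ0, hσH]
    exact CoprodI.lift_of _ _
  · rw [MonoidHom.comp_apply, hσ0, hσK]
    exact CoprodI.lift_of _ _
  · rw [MonoidHom.comp_apply, hσ1]
    exact CoprodI.lift_of _ _

end FreeFactor

theorem closure_insert_t_range_of {G : Type*} [Group G] {A B : Subgroup G} {φ : A ≃* B} :
    Subgroup.closure (insert HNNExtension.t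
      (Set.range (HNNExtension.of : G →* HNNExtension G A B φ))) = ⊤ := by
  refine eq_top_iff.2 fun x _ => ?_
  induction x using HNNExtension.induction_on with
  | of g => exact Subgroup.subset_closure (Set.mem_insert_of_mem _ ⟨g, rfl⟩)
  | t => exact Subgroup.subset_closure (Set.mem_insert _ _)
  | mul x y hx hy => exact mul_mem (hx trivial) (hy trivial)
  | inv x hx => exact inv_mem (hx trivial)

theorem isFinitelyPresented_of_hnnExtension_top {D : Type*} [Group D] [IsFreeGroup D]
    {θ : D →* D} {B : Subgroup D} {φ : (⊤ : Subgroup D) ≃* B} (hφ : ∀ d, (φ d : D) = θ d)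
    {K : Subgroup (HNNExtension D ⊤ B φ)} (hK : K.FG) : Group.IsFinitelyPresented K := by
  refine isFinitelyPresented_of_fg (f := HNNExtension.of) (θ := θ) (t := HNNExtension.t)
    (τ := HNNExtension.lift 1 (Multiplicative.ofAdd 1) (by simp)) (HNNExtension.of_injective φ)
    (fun d => ?_) closure_insert_t_range_of (fun d => by simp) (by simp) hK
  rw [← hφ ⟨d, Subgroup.mem_top d⟩, HNNExtension.equiv_eq_conj]

/-- The HNN extension along a monomorphism of a free factor embeds into an ascending HNN extension
of a free group, hence is coherent. -/
theorem isFinitelyPresented_of_hnnExtension_freeFactor {F : Type*} [Group F] [IsFreeGroup F]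
    {H : Subgroup F} (hH : IsProperFreeFactor H) {Ψ : H →* F} (hΨ : Function.Injective Ψ)
    {K : Subgroup (HNNExtension F H Ψ.range (MonoidHom.ofInjective hΨ))} (hK : K.FG) :
    Group.IsFinitelyPresented K := by
  obtain ⟨L, -, hHL⟩ := hH
  obtain ⟨θ, hθ, hθH, hθL, hθs⟩ := exists_injective_hom_coprodI hHL hΨ
  let φ := (Subgroup.topEquiv (G := Monoid.CoprodI fun _ : ℕ => F)).trans
    (MonoidHom.ofInjective hθ)
  have hφ : ∀ d, (φ d : Monoid.CoprodI fun _ : ℕ => F) = θ d := fun d => rfl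
  let α : HNNExtension F H Ψ.range (MonoidHom.ofInjective hΨ) →*
      HNNExtension (Monoid.CoprodI fun _ : ℕ => F) ⊤ _ φ :=
    HNNExtension.lift (HNNExtension.of.comp (copyHom F 0)) HNNExtension.t
      fun h => by
        change HNNExtension.t * HNNExtension.of (copyHom F 0 (h : F)) =
          HNNExtension.of (copyHom F 0 (Ψ h)) * HNNExtension.t
        rw [← hθH]
        exact HNNExtension.t_mul_of (φ := φ) ⟨copyHom F 0 (h : F), trivial⟩
  let ρ : Monoid.CoprodI (fun _ : ℕ => F) →*
      HNNExtension F H Ψ.range (MonoidHom.ofInjective hΨ) :=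
    Monoid.CoprodI.lift fun n => (MulAut.conj (HNNExtension.t ^ n)).toMonoidHom.comp
      HNNExtension.of
  have hρ : ∀ n x, ρ (copyHom F n x) =
      HNNExtension.t ^ n * HNNExtension.of x * (HNNExtension.t ^ n)⁻¹ :=
    fun n x => Monoid.CoprodI.lift_of _ _
  have hρθ : (MulAut.conj HNNExtension.t).toMonoidHom.comp ρ = ρ.comp θ := by
    refine Monoid.CoprodI.ext_hom _ _ fun i => ?_
    cases i with
    | zero =>
      refine hom_ext_of_bijective hHL (fun h => ?_) fun k => ?_
      · change HNNExtension.t * ρ (copyHom F 0 (h : F)) * HNNExtension.t⁻¹ =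
          ρ (θ (copyHom F 0 (h : F)))
        rw [hθH, hρ, hρ]
        simpa only [pow_zero, one_mul, inv_one, mul_one, MonoidHom.ofInjective_apply] using
          (HNNExtension.equiv_eq_conj (φ := MonoidHom.ofInjective hΨ) h).symm
      · change HNNExtension.t * ρ (copyHom F 0 (k : F)) * HNNExtension.t⁻¹ =
          ρ (θ (copyHom F 0 (k : F)))
        rw [hθL, hρ, hρ]
        simp
    | succ n =>
      ext x
      change HNNExtension.t * ρ (copyHom F (n + 1) x) * HNNExtension.t⁻¹ =
        ρ (θ (copyHom F (n + 1) x))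
      rw [hθs, hρ, hρ, pow_succ' _ (n + 1)]
      group
  let β : HNNExtension (Monoid.CoprodI fun _ : ℕ => F) ⊤ _ φ →*
      HNNExtension F H Ψ.range (MonoidHom.ofInjective hΨ) :=
    HNNExtension.lift ρ HNNExtension.t fun d => by
      rw [hφ, ← mul_inv_eq_iff_eq_mul]
      exact DFunLike.congr_fun hρθ (d : Monoid.CoprodI fun _ : ℕ => F)
  have hβα : β.comp α = MonoidHom.id _ := by
    refine HNNExtension.hom_ext ?_ ?_
    · ext x
      simp [α, β, hρ]
    · simp [α, β]
  have hα : Function.Injective α := Function.LeftInverse.injective (DFunLike.congr_fun hβα)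
  have hfg : (K.map α).FG :=
    (Subgroup.fg_iff_submonoid_fg _).2 (((Subgroup.fg_iff_submonoid_fg _).1 hK).map α)
  have hfp := isFinitelyPresented_of_hnnExtension_top hφ hfg
  exact hfp.equiv (K.equivMapOfInjective α hα).symm

/-- **Theorem 1.4 + Theorem 2.1.** Let `H` be a proper free factor of a finitely
generated free group `F` and `Ψ : H → F` a fully irreducible monomorphism. Then the
HNN extension `G` of `F` associating `H` to `Ψ(H)` is coherent: every finitely
generated subgroup of `G` is finitely presented. -/
theorem coherent_of_fullyIrreducible {ι : Type} [Finite ι]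
    (H : Subgroup (FreeGroup ι)) (hH : IsProperFreeFactor H)
    (Ψ : ↥H →* FreeGroup ι) (hΨ : Function.Injective Ψ)
    (hirr : FullyIrreducible H Ψ) :
    ∀ K : Subgroup (HNNExtension (FreeGroup ι) H Ψ.range (MonoidHom.ofInjective hΨ)),
      K.FG → ∃ (α : Type) (_ : Finite α) (rels : Set (FreeGroup α)),
        rels.Finite ∧ Nonempty (↥K ≃* PresentedGroup rels) := by
  intro K hK
  have := isFinitelyPresented_of_hnnExtension_freeFactor hH hΨ hK
  obtain ⟨n, rels, hrels, h⟩ := Group.IsFinitelyPresented.exists_mulEquiv_presentedGroup (G := K)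
  exact ⟨Fin n, inferInstance, rels, hrels, h⟩
end
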